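/- Under the stated hypotheses, the Hamming type 246 (K,K,K) three-term relation holds: A(1−a, 1−b, 1−c, 1−d)·A(1+a−e, 1+b−e, 1+c−e, 1+d−e)·B_2(a,b,c,d,e,f,g)·K(a;b,c,d;e,f,g) + S(e)·A(f−a, f−b, f−c, f−d)·A(g−a, g−b, g−c, g−d)·(A(a, 1+a−e, 1+a−f, 1+a−g))²·K(1−a; 1−b, 1−c, 1−d; 2−e, 2−f, 2−g) − C(a,b,c,d,e,f,g)·K(1+a−e; 1+b−e, 1+c−e, 1+d−e; 2−e, 1+f−e, 1+g−e) = 0. -/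

import Mathlib

noncomputable section

open Complex

/-- `Sn x = sin (π x)`. -/
def Sn (x : ℂ) : ℂ := Complex.sin ((Real.pi : ℂ) * x)

/-- The renormalized Saalschützian series
`F*(a,b,c,d;e,f,g) = ∑ₖ Γ(k+a)Γ(k+b)Γ(k+c)Γ(k+d)/(k!·Γ(k+e)Γ(k+f)Γ(k+g))`. -/
def Fstar (a b c d e f g : ℂ) : ℂ :=
  ∑' k : ℕ, (Complex.Gamma (k + a) * Complex.Gamma (k + b) *
      Complex.Gamma (k + c) * Complex.Gamma (k + d)) /
    ((k.factorial : ℂ) * Complex.Gamma (k + e) * Complex.Gamma (k + f) *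
      Complex.Gamma (k + g))

/-- The function `K(a;b,c,d;e,f,g)`. -/
def Kf (a b c d e f g : ℂ) : ℂ :=
  (Fstar a b c d e f g +
      Fstar a (1 + a - e) (1 + a - f) (1 + a - g) (1 + a - b) (1 + a - c) (1 + a - d)) /
    (Sn a * Complex.Gamma a ^ 2 * Complex.Gamma b * Complex.Gamma c * Complex.Gamma d *
      Complex.Gamma (1 + a - e) * Complex.Gamma (1 + a - f) * Complex.Gamma (1 + a - g))

/-- The function `L(a,b,c,d;e;f,g)`. -/
def Lf (a b c d e f g : ℂ) : ℂ :=
  (Fstar a b c d e f g -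
      Fstar (1 + a - e) (1 + b - e) (1 + c - e) (1 + d - e) (2 - e) (1 + f - e) (1 + g - e)) /
    (Sn e * Complex.Gamma a * Complex.Gamma b * Complex.Gamma c * Complex.Gamma d *
      Complex.Gamma (1 + a - e) * Complex.Gamma (1 + b - e) * Complex.Gamma (1 + c - e) *
      Complex.Gamma (1 + d - e))

/-- `A(x,y,z,t) = 1/(Γ(x)Γ(y)Γ(z)Γ(t))`. -/
def Af (x y z t : ℂ) : ℂ :=
  1 / (Complex.Gamma x * Complex.Gamma y * Complex.Gamma z * Complex.Gamma t)

def B1 (a b c d e f g : ℂ) : ℂ :=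
  Sn b * Sn c * (Sn (b - a) * Sn (c - a) * Sn d + Sn (e - a) * Sn (f - a) * Sn (g - a)) /
    (Real.pi : ℂ) ^ 4

def B2 (a b c d e f g : ℂ) : ℂ :=
  Sn (f - a) * Sn (g - a) *
    (Sn (b - a) * Sn (c - a) * Sn (d - a) + Sn (e - 2 * a) * Sn (f - a) * Sn (g - a)) /
    (Real.pi : ℂ) ^ 4

def B3 (a b c d e f g : ℂ) : ℂ :=
  (Sn f * Sn (f - e) * Sn (g - a) * Sn (g - b) * Sn (g - c) * Sn (g - d) -
      Sn g * Sn (g - e) * Sn (f - a) * Sn (f - b) * Sn (f - c) * Sn (f - d)) /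
    ((Real.pi : ℂ) ^ 4 * Sn (f - g))

def B4 (a b c d e f g : ℂ) : ℂ :=
  Sn (f - a) * Sn (g - a) * (Sn b * Sn c * Sn d + Sn (e - a) * Sn f * Sn g) /
    (Real.pi : ℂ) ^ 4

def B5 (a b c d e f g : ℂ) : ℂ :=
  Sn b * Sn (e - b) *
    (Sn (b - a) * Sn (c - a) * Sn (d - a) + Sn (e - 2 * a) * Sn (f - a) * Sn (g - a)) /
    (Real.pi : ℂ) ^ 4

def Cf (a b c d e f g : ℂ) : ℂ :=
  Sn (e - a) * (Sn b * Sn c * Sn d * B2 a b c d e f g +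
      Sn e * Sn (f - a) * Sn (g - a) * B4 a b c d e f g) / (Real.pi : ℂ) ^ 4

open Filter Topology

lemma tendsto_Gamma_nat_add (x : ℂ) :
    Tendsto (fun n : ℕ => Gamma (n + 1 + x) / ((n.factorial : ℂ) * (n : ℂ) ^ x)) atTop (𝓝 1) := by
  obtain ⟨m, hm⟩ := exists_nat_gt (-x.re)
  induction m generalizing x with
  | zero =>
    have hx : 0 < x.re := by simpa using hm
    have h0 : Gamma x ≠ 0 := Gamma_ne_zero_of_re_pos hx
    have h1 : Tendsto (fun n => Gamma x / GammaSeq x n) atTop (𝓝 1) := by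
      rw [← div_self h0]
      exact tendsto_const_nhds.div (GammaSeq_tendsto_Gamma x) h0
    refine h1.congr fun n => ?_
    have hz : ∀ k : ℕ, x ≠ -k := by
      rintro k rfl
      simp only [neg_re, natCast_re] at hx
      linarith [(Nat.cast_nonneg k : (0 : ℝ) ≤ k)]
    have h2 := Gamma_add_nat_div_Gamma_eq (n := n + 1) x hz
    rw [GammaSeq, show (n : ℂ) + 1 + x = x + (n + 1 : ℕ) by push_cast; ring]
    rw [div_eq_iff h0] at h2
    rw [h2, div_div_eq_mul_div, mul_comm (Gamma x), mul_comm ((n : ℂ) ^ x)]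
    congr 2
    induction n + 1 with
    | zero => simp
    | succ k ihk => rw [Finset.prod_range_succ, ihk, ascPochhammer_succ_eval]
  | succ m ih =>
    have h1 := ih (x + 1) (by simp only [add_re, one_re]; push_cast at hm; linarith)
    have h2 : Tendsto (fun n : ℕ => (n : ℂ) / (n + (1 + x))) atTop (𝓝 1) := by
      simpa using tendsto_natCast_div_add_atTop (𝕜 := ℂ) (1 + x)
    have h3 := h1.mul h2
    rw [one_mul] at h3
    refine h3.congr' ?_
    obtain ⟨N, hN⟩ := exists_nat_gt (‖1 + x‖)
    filter_upwards [eventually_gt_atTop N] with n hn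
    have hn0 : (n : ℂ) ≠ 0 := Nat.cast_ne_zero.mpr (by omega)
    have hne : (n : ℂ) + 1 + x ≠ 0 := by
      intro h
      have h5 : (n : ℂ) = -(1 + x) := by linear_combination h
      have h4 : ‖(n : ℂ)‖ = ‖1 + x‖ := by rw [h5, norm_neg]
      rw [Complex.norm_natCast] at h4
      have : (N : ℝ) < n := by exact_mod_cast hn
      linarith
    rw [show (n : ℂ) + 1 + (x + 1) = (n + 1 + x) + 1 by ring, Gamma_add_one _ hne,
      cpow_add _ _ hn0, cpow_one, ← add_assoc]
    have : (n : ℂ) ^ x ≠ 0 := by simp [hn0]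
    field_simp

lemma tendsto_Gamma_ratio (x y : ℂ) :
    Tendsto (fun n : ℕ => Gamma (n + x) / Gamma (n + y) * ((n : ℂ) + 1) ^ (y - x)) atTop
      (𝓝 1) := by
  have h := ((tendsto_Gamma_nat_add (x - 2)).div (tendsto_Gamma_nat_add (y - 2))
    one_ne_zero).comp (tendsto_add_atTop_nat 1)
  rw [div_one] at h
  refine h.congr fun n => ?_
  have hn0 : (n : ℂ) + 1 ≠ 0 := by exact_mod_cast Nat.succ_ne_zero n
  have hf : ((n + 1).factorial : ℂ) ≠ 0 := by exact_mod_cast Nat.factorial_ne_zero _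
  have hp : ∀ z : ℂ, ((n : ℂ) + 1) ^ z ≠ 0 := fun z => by simp [hn0]
  simp only [Function.comp_apply, Pi.div_apply, Nat.cast_add, Nat.cast_one]
  rw [show (n : ℂ) + 1 + 1 + (x - 2) = n + x by ring,
    show (n : ℂ) + 1 + 1 + (y - 2) = n + y by ring]
  by_cases hy : Gamma (n + y) = 0
  · simp [hy]
  have e : ((n : ℂ) + 1) ^ (y - 2) = (n + 1) ^ (y - x) * (n + 1) ^ (x - 2) := by
    rw [← cpow_add _ _ hn0]; congr 1; ring
  rw [e]
  field_simp [hp (y - x), hp (x - 2)]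

lemma Gamma_ratio_bound (x y : ℂ) :
    ∃ C : ℝ, 0 < C ∧ ∀ n : ℕ,
      ‖Gamma (n + x) / Gamma (n + y)‖ ≤ C * ((n : ℝ) + 1) ^ (x - y).re := by
  obtain ⟨C, hC⟩ := (tendsto_Gamma_ratio x y).norm.bddAbove_range
  refine ⟨max C 1, by positivity, fun n => ?_⟩
  have h := (hC (Set.mem_range_self n)).trans (le_max_left C 1)
  have hn : (0 : ℝ) < (n : ℝ) + 1 := by positivity
  have hnorm : ∀ z : ℂ, ‖((n : ℂ) + 1) ^ z‖ = ((n : ℝ) + 1) ^ z.re := fun z => by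
    have := norm_cpow_eq_rpow_re_of_pos hn z
    push_cast at this
    exact this
  simp only [norm_mul, hnorm] at h ⊢
  have hp : 0 < ((n : ℝ) + 1) ^ (x - y).re := by positivity
  calc _ = ‖Gamma (n + x) / Gamma (n + y)‖ * ((n : ℝ) + 1) ^ (y - x).re *
        ((n : ℝ) + 1) ^ (x - y).re := by
        rw [mul_assoc, ← Real.rpow_add hn]; simp
    _ ≤ _ := by gcongr

lemma summable_rpow_succ {p : ℝ} (hp : p < -1) : Summable fun n : ℕ => ((n : ℝ) + 1) ^ p := by
  have := (summable_nat_add_iff 1).mpr (Real.summable_nat_rpow.mpr hp)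
  simpa using this

lemma Gamma_ratio_bound_two (x y x' y' : ℂ) :
    ∃ C : ℝ, 0 < C ∧ ∀ n : ℕ,
      ‖Gamma (n + x) / Gamma (n + y) * (Gamma (n + x') / Gamma (n + y'))‖ ≤
        C * ((n : ℝ) + 1) ^ (x - y + (x' - y')).re := by
  obtain ⟨C, hC, h⟩ := Gamma_ratio_bound x y
  obtain ⟨D, hD, h'⟩ := Gamma_ratio_bound x' y'
  refine ⟨C * D, by positivity, fun n => ?_⟩
  have hn : (0 : ℝ) < (n : ℝ) + 1 := by positivity
  rw [norm_mul, add_re, Real.rpow_add hn]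
  calc _ ≤ (C * ((n : ℝ) + 1) ^ (x - y).re) * (D * ((n : ℝ) + 1) ^ (x' - y').re) := by
        gcongr
        exacts [h n, h' n]
    _ = _ := by ring

lemma Gamma_ratio_bound_four (x₁ y₁ x₂ y₂ x₃ y₃ x₄ y₄ : ℂ) :
    ∃ C : ℝ, 0 < C ∧ ∀ n : ℕ,
      ‖Gamma (n + x₁) / Gamma (n + y₁) * (Gamma (n + x₂) / Gamma (n + y₂)) *
        (Gamma (n + x₃) / Gamma (n + y₃) * (Gamma (n + x₄) / Gamma (n + y₄)))‖ ≤
        C * ((n : ℝ) + 1) ^ (x₁ - y₁ + (x₂ - y₂) + (x₃ - y₃ + (x₄ - y₄))).re := by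
  obtain ⟨C, hC, h⟩ := Gamma_ratio_bound_two x₁ y₁ x₂ y₂
  obtain ⟨D, hD, h'⟩ := Gamma_ratio_bound_two x₃ y₃ x₄ y₄
  refine ⟨C * D, by positivity, fun n => ?_⟩
  have hn : (0 : ℝ) < (n : ℝ) + 1 := by positivity
  rw [norm_mul, add_re, Real.rpow_add hn]
  calc _ ≤ (C * ((n : ℝ) + 1) ^ (x₁ - y₁ + (x₂ - y₂)).re) *
        (D * ((n : ℝ) + 1) ^ (x₃ - y₃ + (x₄ - y₄)).re) := by
        gcongr
        exacts [h n, h' n]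
    _ = _ := by ring

lemma summable_of_rpow_bound {u : ℕ → ℂ} {C p : ℝ} (hp : p < -1)
    (h : ∀ n : ℕ, ‖u n‖ ≤ C * ((n : ℝ) + 1) ^ p) : Summable u :=
  .of_norm_bounded ((summable_rpow_succ hp).mul_left C) h

lemma tsum_telescope {G : ℕ → ℂ} {L : ℂ} (hs : Summable fun k => G (k + 1) - G k)
    (hL : Tendsto G atTop (𝓝 L)) : ∑' k, (G (k + 1) - G k) = L - G 0 := by
  refine tendsto_nhds_unique hs.hasSum.tendsto_sum_nat ?_
  simp only [Finset.sum_range_sub]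
  exact hL.sub_const _

lemma Gamma_ne_zero_iff {x : ℂ} : Gamma x ≠ 0 ↔ ∀ m : ℕ, x ≠ -m := by
  rw [Ne, Gamma_eq_zero_iff]; push Not; rfl

lemma add_nat_ne_zero {x : ℂ} (hx : Gamma x ≠ 0) (n : ℕ) : x + n ≠ 0 := fun h =>
  Gamma_ne_zero_iff.mp hx n (by linear_combination h)

lemma Gamma_add_nat_ne_zero {x : ℂ} (hx : Gamma x ≠ 0) (n : ℕ) : Gamma (x + n) ≠ 0 :=
  Gamma_ne_zero_iff.mpr fun m h => add_nat_ne_zero hx (m + n) (by push_cast; linear_combination h)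

lemma Gamma_nat_succ_add {x : ℂ} (hx : Gamma x ≠ 0) (n : ℕ) :
    Gamma ((n + 1 : ℕ) + x) = (x + n) * Gamma (n + x) := by
  rw [show ((n + 1 : ℕ) : ℂ) + x = (n + x) + 1 by push_cast; ring,
    Gamma_add_one _ (by rw [add_comm]; exact add_nat_ne_zero hx n), add_comm x]

lemma inv_Gamma_rec (x : ℂ) : (Gamma x)⁻¹ = x * (Gamma (x + 1))⁻¹ :=
  one_div_Gamma_eq_self_mul_one_div_Gamma_add_one x

/-- Terms of the Gauss series, unnormalized. -/
def gaussTerm (a b c : ℂ) (k : ℕ) : ℂ :=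
  Gamma (k + a) * Gamma (k + b) / (k.factorial * Gamma (k + c))

lemma gaussTerm_eq (a b c : ℂ) (k : ℕ) : gaussTerm a b c k =
    Gamma (k + a) / Gamma (k + 1) * (Gamma (k + b) / Gamma (k + c)) := by
  rw [gaussTerm, Gamma_nat_eq_factorial, div_mul_div_comm]

lemma summable_gaussTerm {a b c : ℂ} (h : 0 < (c - a - b).re) : Summable (gaussTerm a b c) := by
  obtain ⟨C, -, hC⟩ := Gamma_ratio_bound_two a 1 b c
  refine summable_of_rpow_bound (C := C) (p := (a - 1 + (b - c)).re) ?_ fun n => ?_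
  · simp only [sub_re, add_re, one_re] at *; linarith
  · rw [gaussTerm_eq]; exact hC n

lemma gauss_shift {a b c : ℂ} (ha : Gamma a ≠ 0) (hb : Gamma b ≠ 0) (h : 0 < (c - a - b).re) :
    (c - a - b) * ∑' k, gaussTerm a b c k =
      (c - a) * (c - b) * ∑' k, gaussTerm a b (c + 1) k := by
  have h' : 0 < (c + 1 - a - b).re := by simp only [sub_re, add_re, one_re] at *; linarith
  have key : ∀ k : ℕ, (c - a) * (c - b) * gaussTerm a b (c + 1) k -
      (c - a - b) * gaussTerm a b c k =
      ((k + 1 : ℕ) : ℂ) * gaussTerm a b c (k + 1) - (k : ℂ) * gaussTerm a b c k := by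
    intro k
    have e1 := inv_Gamma_rec (k + c)
    have hf : (k.factorial : ℂ) ≠ 0 := by exact_mod_cast k.factorial_ne_zero
    have hk : (k : ℂ) + 1 ≠ 0 := by exact_mod_cast Nat.succ_ne_zero k
    simp only [gaussTerm, Gamma_nat_succ_add ha, Gamma_nat_succ_add hb, Nat.factorial_succ]
    rw [show ((k + 1 : ℕ) : ℂ) + c = k + c + 1 by push_cast; ring,
      show (k : ℂ) + (c + 1) = k + c + 1 by ring]
    push_cast
    simp only [div_eq_mul_inv, mul_inv, e1]
    field_simp
    ring
  have hs := ((summable_gaussTerm h').mul_left ((c - a) * (c - b))).sub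
    ((summable_gaussTerm h).mul_left (c - a - b))
  have hlim : Tendsto (fun k : ℕ => (k : ℂ) * gaussTerm a b c k) atTop (𝓝 0) := by
    obtain ⟨C, -, hC⟩ := Gamma_ratio_bound_two a 1 b c
    have h0 : Tendsto (fun n : ℕ => C * ((n : ℝ) + 1) ^ (-(c - a - b).re)) atTop (𝓝 0) := by
      rw [← mul_zero C]
      exact ((tendsto_rpow_neg_atTop h).comp
        (tendsto_atTop_add_const_right _ 1 tendsto_natCast_atTop_atTop)).const_mul C
    refine squeeze_zero_norm (fun n => ?_) h0
    have hn : (0 : ℝ) < (n : ℝ) + 1 := by positivity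
    rw [norm_mul, Complex.norm_natCast, gaussTerm_eq,
      show -(c - a - b).re = 1 + (a - 1 + (b - c)).re by simp; ring, Real.rpow_add hn,
      Real.rpow_one, mul_left_comm]
    gcongr
    · linarith
    · exact hC n
  have ht := tsum_telescope (by simpa only [key] using hs) hlim
  simp only [← key] at ht
  rw [((summable_gaussTerm h').mul_left _).tsum_sub ((summable_gaussTerm h).mul_left _),
    tsum_mul_left, tsum_mul_left] at ht
  simp only [Nat.cast_zero, zero_mul, sub_zero] at ht
  linear_combination -ht

lemma norm_Gamma_div_Gamma_add_nat_le {z : ℂ} {σ : ℝ} (hσ : 0 < σ) (h : σ ≤ z.re) (k : ℕ) :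
    ‖Gamma z / Gamma (z + k)‖ ≤ Real.Gamma σ / Real.Gamma (σ + k) := by
  have hz : Gamma z ≠ 0 := Gamma_ne_zero_of_re_pos (hσ.trans_le h)
  induction k with
  | zero => simp [hz, (Real.Gamma_pos_of_pos hσ).ne']
  | succ k ih =>
    have h1 : z + k ≠ 0 := add_nat_ne_zero hz k
    have h2 : σ + k ≠ 0 := by positivity
    push_cast
    rw [← add_assoc, ← add_assoc, Gamma_add_one _ h1, Real.Gamma_add_one h2, div_mul_eq_div_div,
      div_mul_eq_div_div, div_right_comm, norm_div, div_right_comm]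
    have h3 : σ + k ≤ ‖z + k‖ := by
      refine le_trans ?_ (re_le_norm _)
      simp; linarith
    have h4 : 0 < σ + k := by positivity
    have h5 : 0 ≤ Real.Gamma σ / Real.Gamma (σ + k) := (norm_nonneg _).trans ih
    gcongr

lemma tendsto_gauss (a b c : ℂ) :
    Tendsto (fun n : ℕ => Gamma (c + n) * ∑' k, gaussTerm a b (c + n) k) atTop
      (𝓝 (Gamma a * Gamma b)) := by
  obtain ⟨σ, hσ0, hσ⟩ : ∃ σ : ℝ, 0 < σ ∧ (a + b).re < σ :=
    ⟨max (a + b).re 0 + 1, by positivity, by linarith [le_max_left (a + b).re 0]⟩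
  have hsum : Summable fun k => ‖gaussTerm a b σ k‖ :=
    (summable_gaussTerm (c := σ) (by simp at *; linarith)).norm
  have e : ∀ n k, Gamma (c + (n : ℕ)) * gaussTerm a b (c + n) k =
      Gamma (k + a) * Gamma (k + b) / k.factorial * (Gamma (c + n) / Gamma (c + n + k)) := by
    intro n k
    rw [gaussTerm, add_comm (k : ℂ) (c + n)]
    simp only [div_eq_mul_inv, mul_inv]; ring
  have hlim : ∑' k : ℕ, (if k = 0 then Gamma a * Gamma b else 0) = Gamma a * Gamma b :=
    tsum_ite_eq 0 _
  simp only [← tsum_mul_left, e]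
  rw [← hlim]
  refine tendsto_tsum_of_dominated_convergence
    (bound := fun k => ‖Gamma σ‖ * ‖gaussTerm a b σ k‖) (hsum.mul_left _) (fun k => ?_) ?_
  · rcases Nat.eq_zero_or_pos k with rfl | hk
    · simp only [if_true, Nat.cast_zero, add_zero, zero_add, Nat.factorial_zero, Nat.cast_one,
        div_one]
      obtain ⟨N, hN⟩ := exists_nat_gt (-c.re)
      refine tendsto_const_nhds.congr' ?_
      filter_upwards [eventually_ge_atTop N] with n hn
      have : Gamma (c + n) ≠ 0 := Gamma_ne_zero_of_re_pos (by
        have : (N : ℝ) ≤ n := by exact_mod_cast hn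
        simp; linarith)
      rw [div_self this, mul_one]
    · rw [if_neg hk.ne', ← mul_zero (Gamma (k + a) * Gamma (k + b) / k.factorial)]
      refine Tendsto.const_mul _ ?_
      obtain ⟨C, -, hC⟩ := Gamma_ratio_bound c (c + k)
      have h0 : Tendsto (fun n : ℕ => C * ((n : ℝ) + 1) ^ (-(k : ℝ))) atTop (𝓝 0) := by
        rw [← mul_zero C]
        exact ((tendsto_rpow_neg_atTop (by exact_mod_cast hk)).comp
          (tendsto_atTop_add_const_right _ 1 tendsto_natCast_atTop_atTop)).const_mul C
      refine squeeze_zero_norm (fun n => ?_) h0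
      have := hC n
      rwa [show (c - (c + k)).re = -(k : ℝ) by simp, add_comm (n : ℂ) c,
        show (n : ℂ) + (c + k) = c + n + k by ring] at this
  · obtain ⟨N, hN⟩ := exists_nat_gt (σ - c.re)
    filter_upwards [eventually_ge_atTop N] with n hn k
    have h1 : (N : ℝ) ≤ n := by exact_mod_cast hn
    have h2 := norm_Gamma_div_Gamma_add_nat_le (z := c + n) hσ0 (by simp; linarith) k
    have h3 : ‖Gamma σ‖ * ‖gaussTerm a b σ k‖ = ‖Gamma (k + a) * Gamma (k + b) / k.factorial‖ *
        (Real.Gamma σ / Real.Gamma (σ + k)) := by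
      have g1 : ‖Gamma (σ : ℂ)‖ = Real.Gamma σ := by
        rw [Gamma_ofReal, norm_real, Real.norm_of_nonneg (Real.Gamma_pos_of_pos hσ0).le]
      have g2 : ‖Gamma ((k : ℂ) + σ)‖ = Real.Gamma (σ + k) := by
        rw [show (k : ℂ) + σ = ((σ + k : ℝ) : ℂ) by push_cast; ring, Gamma_ofReal, norm_real,
          Real.norm_of_nonneg (Real.Gamma_pos_of_pos (by positivity)).le]
      rw [gaussTerm]
      simp only [norm_div, norm_mul, g1, g2]
      simp only [div_eq_mul_inv, mul_inv]; ring
    rw [h3, norm_mul]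
    gcongr

/-- The Gauss summation theorem. -/
theorem tsum_gaussTerm {a b c : ℂ} (ha : Gamma a ≠ 0) (hb : Gamma b ≠ 0)
    (hca : Gamma (c - a) ≠ 0) (hcb : Gamma (c - b) ≠ 0) (h : 0 < (c - a - b).re) :
    ∑' k, gaussTerm a b c k =
      Gamma a * Gamma b * Gamma (c - a - b) / (Gamma (c - a) * Gamma (c - b)) := by
  set H : ℕ → ℂ := fun n => (∑' k, gaussTerm a b (c + n) k) *
    (Gamma (n + (c - a)) * Gamma (n + (c - b)) / Gamma (n + (c - a - b))) with hH
  have h0 : Gamma (c - a - b) ≠ 0 := Gamma_ne_zero_of_re_pos h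
  have hstep : ∀ n, H (n + 1) = H n := by
    intro n
    have h1 : 0 < (c + n - a - b).re := by
      simp only [sub_re, add_re, natCast_re] at *
      have : (0 : ℝ) ≤ n := by positivity
      linarith
    have h2 := gauss_shift ha hb h1
    have h3 := add_nat_ne_zero h0 n
    have h4 := Gamma_add_nat_ne_zero h0 n
    rw [add_comm] at h4
    simp only [hH, Gamma_nat_succ_add h0, Gamma_nat_succ_add hca, Gamma_nat_succ_add hcb]
    push_cast
    rw [← add_assoc c]
    field_simp
    linear_combination (-(Gamma (n + (c - a)) * Gamma (n + (c - b)))) * h2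
  have hconst : ∀ n, H n = H 0 := fun n => by
    induction n with
    | zero => rfl
    | succ n ih => rw [hstep, ih]
  have hlim : Tendsto H atTop (𝓝 (Gamma a * Gamma b * (1 * 1))) := by
    have t := (tendsto_gauss a b c).mul
      ((tendsto_Gamma_ratio (c - a) (c - a - b)).mul (tendsto_Gamma_ratio (c - b) c))
    obtain ⟨N, hN⟩ := exists_nat_gt (-c.re)
    refine t.congr' ?_
    filter_upwards [eventually_ge_atTop N] with n hn
    have hc : Gamma (n + c) ≠ 0 := Gamma_ne_zero_of_re_pos (by
      have : (N : ℝ) ≤ n := by exact_mod_cast hn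
      simp; linarith)
    have hn0 : (n : ℂ) + 1 ≠ 0 := by exact_mod_cast Nat.succ_ne_zero n
    have hp : ((n : ℂ) + 1) ^ (c - a - b - (c - a)) * ((n : ℂ) + 1) ^ (c - (c - b)) = 1 := by
      rw [← cpow_add _ _ hn0]; ring_nf; exact cpow_zero _
    simp only [hH, add_comm c]
    have h4 := Gamma_add_nat_ne_zero h0 n
    rw [add_comm] at h4
    field_simp
    linear_combination ((∑' k, gaussTerm a b (n + c) k) * Gamma (n + (c - a)) *
      Gamma (n + (c - b))) * hp
  have := tendsto_nhds_unique (tendsto_const_nhds.congr fun n => (hconst n).symm) hlim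
  simp only [hH, Nat.cast_zero, add_zero, zero_add, mul_one] at this
  field_simp at this ⊢
  linear_combination this

/-- `x` is not an integer. -/
def NotInt (x : ℂ) : Prop := ∀ n : ℤ, x ≠ n

namespace NotInt

lemma of_eq_add {x y : ℂ} (h : NotInt x) (m : ℤ) (e : y = x + m) : NotInt y := fun n hn =>
  h (n - m) (by push_cast; linear_combination hn - e)

lemma of_eq_sub {x y : ℂ} (h : NotInt x) (m : ℤ) (e : y = m - x) : NotInt y := fun n hn =>
  h (m - n) (by push_cast; linear_combination e - hn)

lemma Gamma_ne_zero {x : ℂ} (h : NotInt x) : Gamma x ≠ 0 :=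
  Gamma_ne_zero_iff.mpr fun m => by simpa using h (-m)

lemma Sn_ne_zero {x : ℂ} (h : NotInt x) : Sn x ≠ 0 := by
  rw [Sn, Ne, Complex.sin_eq_zero_iff]
  rintro ⟨k, hk⟩
  have hpi : (Real.pi : ℂ) ≠ 0 := by exact_mod_cast Real.pi_ne_zero
  exact h k (mul_left_cancel₀ hpi (by linear_combination hk))

lemma inv_Gamma {x y : ℂ} (h : NotInt x) (e : x + y = 1) :
    (Gamma y)⁻¹ = Sn x * Gamma x / Real.pi := by
  have h1 := Complex.Gamma_mul_Gamma_one_sub x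
  rw [show 1 - x = y by linear_combination -e, ← Sn] at h1
  have hy : NotInt y := h.of_eq_sub 1 (by push_cast; linear_combination e)
  have h2 := h.Sn_ne_zero
  have h3 := hy.Gamma_ne_zero
  have hpi : (Real.pi : ℂ) ≠ 0 := by exact_mod_cast Real.pi_ne_zero
  field_simp at h1 ⊢
  linear_combination -h1

end NotInt

lemma Sn_mul_sub_mul (a b e : ℂ) :
    Sn (e - a) * Sn (e - b) - Sn a * Sn b = Sn e * Sn (e - a - b) := by
  simp only [Sn, mul_sub, Complex.sin_sub, Complex.cos_sub]
  linear_combination (Complex.sin (Real.pi * a) * Complex.sin (Real.pi * b)) *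
    Complex.sin_sq_add_cos_sq (Real.pi * e)

/-- Terms of the series `₃F₂(a,b,c;e,f)`, unnormalized. -/
def saalTerm (a b c e f : ℂ) (k : ℕ) : ℂ :=
  Gamma (k + a) * Gamma (k + b) * Gamma (k + c) / (k.factorial * Gamma (k + e) * Gamma (k + f))

lemma saalTerm_eq (a b c e f : ℂ) (k : ℕ) : saalTerm a b c e f k =
    gaussTerm a b e k * (Gamma (k + c) / Gamma (k + f)) := by
  rw [saalTerm, gaussTerm, div_mul_div_comm]

lemma gaussTerm_bound (a b c : ℂ) : ∃ C : ℝ, 0 < C ∧ ∀ k : ℕ,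
    ‖gaussTerm a b c k‖ ≤ C * ((k : ℝ) + 1) ^ ((a + b - c).re - 1) := by
  obtain ⟨C, hC, h⟩ := Gamma_ratio_bound_two a 1 b c
  refine ⟨C, hC, fun k => ?_⟩
  rw [gaussTerm_eq, show (a + b - c).re - 1 = (a - 1 + (b - c)).re by simp; ring]
  exact h k

lemma saalTerm_bound (a b c e f : ℂ) : ∃ C : ℝ, 0 < C ∧ ∀ k : ℕ,
    ‖saalTerm a b c e f k‖ ≤ C * ((k : ℝ) + 1) ^ ((a + b + c - e - f).re - 1) := by
  obtain ⟨C, hC, h⟩ := gaussTerm_bound a b e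
  obtain ⟨D, hD, h'⟩ := Gamma_ratio_bound c f
  refine ⟨C * D, by positivity, fun k => ?_⟩
  have hn : (0 : ℝ) < (k : ℝ) + 1 := by positivity
  rw [saalTerm_eq, norm_mul, show (a + b + c - e - f).re - 1 = ((a + b - e).re - 1) + (c - f).re by
    simp; ring, Real.rpow_add hn]
  calc _ ≤ (C * ((k : ℝ) + 1) ^ ((a + b - e).re - 1)) * (D * ((k : ℝ) + 1) ^ (c - f).re) := by
        gcongr
        exacts [h k, h' k]
    _ = _ := by ring

lemma summable_saalTerm {a b c e f : ℂ} (h : e + f = a + b + c + 1) :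
    Summable (saalTerm a b c e f) := by
  obtain ⟨C, -, hC⟩ := saalTerm_bound a b c e f
  refine summable_of_rpow_bound (p := (a + b + c - e - f).re - 1) ?_ hC
  rw [show a + b + c - e - f = -1 by linear_combination -h]
  norm_num

lemma saal_shift {a b c e f : ℂ} (ha : Gamma a ≠ 0) (hb : Gamma b ≠ 0) (hc : Gamma c ≠ 0)
    (h : e + f = a + b + c + 1) :
    (f - a) * (f - b) * ∑' k, saalTerm a b (c + 1) e (f + 1) k -
      c * (1 + c - e) * ∑' k, saalTerm a b c e f k = 1 := by
  have h' : e + (f + 1) = a + b + (c + 1) + 1 := by linear_combination h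
  obtain rfl : f = a + b + c + 1 - e := by linear_combination h
  set f := a + b + c + 1 - e with hf
  set G : ℕ → ℂ := fun k => k * (e - 1 + k) * saalTerm a b c e f k with hG
  have key : ∀ k : ℕ, (f - a) * (f - b) * saalTerm a b (c + 1) e (f + 1) k -
      c * (1 + c - e) * saalTerm a b c e f k = G (k + 1) - G k := by
    intro k
    have e1 := inv_Gamma_rec (k + e)
    have e2 := inv_Gamma_rec (k + f)
    have e3 := Gamma_nat_succ_add hc k
    have hfac : (k.factorial : ℂ) ≠ 0 := by exact_mod_cast k.factorial_ne_zero
    have hk : (k : ℂ) + 1 ≠ 0 := by exact_mod_cast Nat.succ_ne_zero k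
    rw [show ((k + 1 : ℕ) : ℂ) + c = k + (c + 1) by push_cast; ring] at e3
    simp only [hG, saalTerm, Gamma_nat_succ_add ha, Gamma_nat_succ_add hb, Gamma_nat_succ_add hc,
      Nat.factorial_succ, e3]
    rw [show ((k + 1 : ℕ) : ℂ) + e = k + e + 1 by push_cast; ring,
      show ((k + 1 : ℕ) : ℂ) + f = k + f + 1 by push_cast; ring, ← add_assoc (k : ℂ) f]
    push_cast
    simp only [div_eq_mul_inv, mul_inv, e1, e2]
    field_simp
    rw [hf]
    ring
  have hs := ((summable_saalTerm h').mul_left ((f - a) * (f - b))).sub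
    ((summable_saalTerm h).mul_left (c * (1 + c - e)))
  have hlim : Tendsto G atTop (𝓝 1) := by
    rw [← tendsto_add_atTop_iff_nat 1]
    have t := (tendsto_Gamma_ratio (1 + a) 1).mul ((tendsto_Gamma_ratio (1 + b) e).mul
      (tendsto_Gamma_ratio (1 + c) (1 + f)))
    simp only [mul_one] at t
    refine t.congr fun n => ?_
    have hn0 : (n : ℂ) + 1 ≠ 0 := by exact_mod_cast Nat.succ_ne_zero n
    have hp : ((n : ℂ) + 1) ^ (1 - (1 + a)) * (((n : ℂ) + 1) ^ (e - (1 + b)) *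
        ((n : ℂ) + 1) ^ (1 + f - (1 + c))) = 1 := by
      rw [← cpow_add _ _ hn0, ← cpow_add _ _ hn0, hf]; ring_nf; exact cpow_zero _
    have e1 := inv_Gamma_rec (n + e)
    have hfac : (n.factorial : ℂ) ≠ 0 := by exact_mod_cast n.factorial_ne_zero
    simp only [hG, saalTerm, Nat.factorial_succ]
    rw [show ((n + 1 : ℕ) : ℂ) + e = n + e + 1 by push_cast; ring, Gamma_nat_eq_factorial,
      show ((n + 1 : ℕ) : ℂ) + f = n + (1 + f) by push_cast; ring,
      show ((n + 1 : ℕ) : ℂ) + a = n + (1 + a) by push_cast; ring,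
      show ((n + 1 : ℕ) : ℂ) + b = n + (1 + b) by push_cast; ring,
      show ((n + 1 : ℕ) : ℂ) + c = n + (1 + c) by push_cast; ring]
    push_cast
    simp only [div_eq_mul_inv, mul_inv, e1]
    rw [show e - 1 + ((n : ℂ) + 1) = n + e by ring]
    field_simp
    linear_combination (Gamma (n + (1 + a)) * Gamma (n + (1 + b)) * Gamma (n + (1 + c)) * (n + e) *
      (Gamma (n + e + 1))⁻¹ * (Gamma (n + (1 + f)))⁻¹) * hp
  have ht := tsum_telescope (by simpa only [key] using hs) hlim
  simp only [← key] at ht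
  rw [((summable_saalTerm h').mul_left _).tsum_sub ((summable_saalTerm h).mul_left _),
    tsum_mul_left, tsum_mul_left] at ht
  simpa [hG] using ht

lemma tendsto_saal {a b c e f : ℂ} (h : e + f = a + b + c + 1) (hre : 1 ≤ (e - a - b).re) :
    Tendsto (fun n : ℕ => (∑' k, saalTerm a b (c + n) e (f + n) k) * ((n : ℂ) + 1) ^ (f - c))
      atTop (𝓝 (∑' k, gaussTerm a b e k)) := by
  obtain ⟨C, hC0, hC⟩ := gaussTerm_bound a b e
  obtain ⟨D, hD0, hD⟩ := Gamma_ratio_bound c f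
  set p := (c - f).re with hp
  have hfc : c - f = e - a - b - 1 := by linear_combination -h
  have hp0 : 0 ≤ p := by rw [hp, hfc]; simp at *; linarith
  have hpe : (a + b - e).re - 1 + p = -2 := by rw [hp, hfc]; simp; ring
  simp only [← tsum_mul_right, saalTerm_eq, mul_assoc]
  refine tendsto_tsum_of_dominated_convergence
    (bound := fun k : ℕ => (C * D) * ((k : ℝ) + 1) ^ (-2 : ℝ))
    ((summable_rpow_succ (by norm_num)).mul_left _) (fun k => ?_) (.of_forall fun n k => ?_)
  · have := (tendsto_Gamma_ratio (k + c) (k + f)).const_mul (gaussTerm a b e k)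
    rw [mul_one] at this
    refine this.congr fun n => ?_
    rw [show (k : ℂ) + (c + n) = n + (k + c) by ring, show (k : ℂ) + (f + n) = n + (k + f) by ring,
      show (k : ℂ) + f - (k + c) = f - c by ring]
  · have hn : (0 : ℝ) < (n : ℝ) + 1 := by positivity
    have hk : (0 : ℝ) < (k : ℝ) + 1 := by positivity
    have h1 := hD (k + n)
    rw [show ((k + n : ℕ) : ℂ) + c = k + (c + n) by push_cast; ring,
      show ((k + n : ℕ) : ℂ) + f = k + (f + n) by push_cast; ring] at h1
    have h2 : ‖((n : ℂ) + 1) ^ (f - c)‖ = ((n : ℝ) + 1) ^ (-p) := by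
      have := norm_cpow_eq_rpow_re_of_pos hn (f - c)
      push_cast at this
      rw [this, hp, show f - c = -(c - f) by ring, neg_re]
    have h3 : (((k + n : ℕ) : ℝ) + 1) ^ p ≤ ((k : ℝ) + 1) ^ p * ((n : ℝ) + 1) ^ p := by
      rw [← Real.mul_rpow hk.le hn.le]
      gcongr
      push_cast
      nlinarith [(by positivity : (0 : ℝ) ≤ k * n)]
    rw [norm_mul, norm_mul, h2]
    calc _ ≤ (C * ((k : ℝ) + 1) ^ ((a + b - e).re - 1)) *
          ((D * (((k : ℝ) + 1) ^ p * ((n : ℝ) + 1) ^ p)) * ((n : ℝ) + 1) ^ (-p)) := by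
          gcongr
          exacts [hC k, h1.trans (by gcongr)]
      _ = C * D * (((k : ℝ) + 1) ^ ((a + b - e).re - 1) * ((k : ℝ) + 1) ^ p) *
          (((n : ℝ) + 1) ^ p * ((n : ℝ) + 1) ^ (-p)) := by ring
      _ = _ := by rw [← Real.rpow_add hk, ← Real.rpow_add hn, hpe]; simp

lemma tsum_gaussTerm_sub {a b e : ℂ} (ha : NotInt a) (hb : NotInt b) (hea : NotInt (e - a))
    (heb : NotInt (e - b)) (h : 0 < (e - a - b).re) :
    ∑' k, gaussTerm a b e k - ∑' k, gaussTerm (1 + a - e) (1 + b - e) (2 - e) k =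
      Sn e / Real.pi * (Gamma a * Gamma b * Gamma (1 + a - e) * Gamma (1 + b - e)) *
        (Gamma (1 + a + b - e))⁻¹ := by
  have hae : NotInt (1 + a - e) := hea.of_eq_sub 1 (by push_cast; ring)
  have hbe : NotInt (1 + b - e) := heb.of_eq_sub 1 (by push_cast; ring)
  have ha' : NotInt (1 - a) := ha.of_eq_sub 1 (by push_cast; ring)
  have hb' : NotInt (1 - b) := hb.of_eq_sub 1 (by push_cast; ring)
  have e1 : (2 - e) - (1 + a - e) = 1 - a := by ring
  have e2 : (2 - e) - (1 + b - e) = 1 - b := by ring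
  have e3 : 1 - a - (1 + b - e) = e - a - b := by ring
  rw [tsum_gaussTerm ha.Gamma_ne_zero hb.Gamma_ne_zero hea.Gamma_ne_zero heb.Gamma_ne_zero h,
    tsum_gaussTerm hae.Gamma_ne_zero hbe.Gamma_ne_zero (by rw [e1]; exact ha'.Gamma_ne_zero)
      (by rw [e2]; exact hb'.Gamma_ne_zero) (by rw [e1, e3]; exact h), e1, e2, e3]
  have hG : (Gamma (1 + a + b - e))⁻¹ = Sn (e - a - b) * Gamma (e - a - b) / Real.pi := by
    by_cases hi : NotInt (e - a - b)
    · exact hi.inv_Gamma (by ring)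
    · obtain ⟨n, hn⟩ : ∃ n : ℤ, e - a - b = n := by simpa [NotInt] using hi
      have hn0 : 0 < n := by rw [hn] at h; exact_mod_cast h
      obtain ⟨m, rfl⟩ : ∃ m : ℕ, n = m + 1 := ⟨(n - 1).toNat, by omega⟩
      have h0 : Gamma (1 + a + b - e) = 0 := by
        rw [show 1 + a + b - e = -(m : ℂ) by push_cast at hn; linear_combination -hn]
        exact Gamma_neg_nat_eq_zero m
      have h1 : Sn (e - a - b) = 0 := by
        rw [hn, Sn, mul_comm]; exact Complex.sin_int_mul_pi _
      rw [h0, h1]; simp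
  simp only [div_eq_mul_inv, mul_inv] at *
  rw [hG, hae.inv_Gamma (y := e - a) (by ring), hbe.inv_Gamma (y := e - b) (by ring),
    ha.inv_Gamma (y := 1 - a) (by ring), hb.inv_Gamma (y := 1 - b) (by ring)]
  have s1 : Sn (1 + a - e) = Sn (e - a) := by
    rw [Sn, Sn, ← Complex.sin_pi_sub]; congr 1; ring
  have s2 : Sn (1 + b - e) = Sn (e - b) := by
    rw [Sn, Sn, ← Complex.sin_pi_sub]; congr 1; ring
  rw [s1, s2]
  linear_combination (Gamma a * Gamma b * Gamma (1 + a - e) * Gamma (1 + b - e) *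
    Gamma (e - a - b) / Real.pi ^ 2) * Sn_mul_sub_mul a b e

/-- The nonterminating form of the Saalschütz theorem. -/
theorem saalschutz {a b c e f : ℂ} (ha : NotInt a) (hb : NotInt b) (hc : NotInt c)
    (hea : NotInt (e - a)) (heb : NotInt (e - b)) (hec : NotInt (e - c))
    (hfa : NotInt (f - a)) (hfb : NotInt (f - b))
    (h : e + f = a + b + c + 1) (hre : 1 ≤ (e - a - b).re) :
    ∑' k, saalTerm a b c e f k -
        ∑' k, saalTerm (1 + a - e) (1 + b - e) (1 + c - e) (2 - e) (1 + f - e) k =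
      Sn e / Real.pi * (Gamma a * Gamma b * Gamma c *
        (Gamma (1 + a - e) * Gamma (1 + b - e) * Gamma (1 + c - e))) *
        (Gamma (f - a) * Gamma (f - b) * Gamma (f - c))⁻¹ := by
  have hae : NotInt (1 + a - e) := hea.of_eq_sub 1 (by push_cast; ring)
  have hbe : NotInt (1 + b - e) := heb.of_eq_sub 1 (by push_cast; ring)
  have hce : NotInt (1 + c - e) := hec.of_eq_sub 1 (by push_cast; ring)
  set V : ℕ → ℂ := fun n => ∑' k, saalTerm a b (c + n) e (f + n) k -
    ∑' k, saalTerm (1 + a - e) (1 + b - e) (1 + c - e + n) (2 - e) (1 + f - e + n) k with hV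
  set H : ℕ → ℂ := fun n => V n * (Gamma (n + (f - a)) * Gamma (n + (f - b)) /
    (Gamma (n + c) * Gamma (n + (1 + c - e)))) with hH
  have hstep : ∀ n, H (n + 1) = H n := by
    intro n
    have h1 := saal_shift (e := e) (f := f + n) ha.Gamma_ne_zero hb.Gamma_ne_zero
      (Gamma_add_nat_ne_zero hc.Gamma_ne_zero n) (by linear_combination h)
    have h2 := saal_shift (e := 2 - e) (f := 1 + f - e + n) hae.Gamma_ne_zero hbe.Gamma_ne_zero
      (Gamma_add_nat_ne_zero hce.Gamma_ne_zero n) (by linear_combination h)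
    have n1 := Gamma_add_nat_ne_zero hc.Gamma_ne_zero n
    have n2 := Gamma_add_nat_ne_zero hce.Gamma_ne_zero n
    have n3 := add_nat_ne_zero hc.Gamma_ne_zero n
    have n4 := add_nat_ne_zero hce.Gamma_ne_zero n
    rw [add_comm] at n1 n2
    simp only [hH, hV, Gamma_nat_succ_add hc.Gamma_ne_zero, Gamma_nat_succ_add hce.Gamma_ne_zero,
      Gamma_nat_succ_add hfa.Gamma_ne_zero, Gamma_nat_succ_add hfb.Gamma_ne_zero]
    push_cast
    simp only [← add_assoc] at *
    rw [mul_div_assoc', mul_div_assoc', div_eq_div_iff (by positivity) (by positivity)]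
    linear_combination (Gamma (n + (f - a)) * Gamma (n + (f - b)) * Gamma (n + c) *
      Gamma (n + (1 + c - e))) * (h1 - h2)
  have hconst : ∀ n, H n = H 0 := fun n => by
    induction n with
    | zero => rfl
    | succ n ih => rw [hstep, ih]
  have hlim : Tendsto H atTop (𝓝 ((∑' k, gaussTerm a b e k -
      ∑' k, gaussTerm (1 + a - e) (1 + b - e) (2 - e) k) * (1 * 1))) := by
    have h2 : 2 - e + (1 + f - e) = 1 + a - e + (1 + b - e) + (1 + c - e) + 1 := by
      linear_combination h
    have t := ((tendsto_saal h hre).sub (tendsto_saal h2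
      (by rwa [show 2 - e - (1 + a - e) - (1 + b - e) = e - a - b by ring]))).mul
      ((tendsto_Gamma_ratio (f - a) c).mul (tendsto_Gamma_ratio (f - b) (1 + c - e)))
    refine t.congr fun n => ?_
    have hn0 : (n : ℂ) + 1 ≠ 0 := by exact_mod_cast Nat.succ_ne_zero n
    have hp : ((n : ℂ) + 1) ^ (f - c) * (((n : ℂ) + 1) ^ (c - (f - a)) *
        ((n : ℂ) + 1) ^ (1 + c - e - (f - b))) = 1 := by
      rw [← cpow_add _ _ hn0, ← cpow_add _ _ hn0,
        show f - c + (c - (f - a) + (1 + c - e - (f - b))) = 0 by linear_combination -h, cpow_zero]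
    simp only [hH, hV]
    rw [show 1 + f - e - (1 + c - e) = f - c by ring, ← div_mul_div_comm]
    linear_combination ((∑' k, saalTerm a b (c + n) e (f + n) k -
      ∑' k, saalTerm (1 + a - e) (1 + b - e) (1 + c - e + n) (2 - e) (1 + f - e + n) k) *
      (Gamma (n + (f - a)) / Gamma (n + c) * (Gamma (n + (f - b)) / Gamma (n + (1 + c - e))))) * hp
  have := tendsto_nhds_unique (tendsto_const_nhds.congr fun n => (hconst n).symm) hlim
  rw [mul_one, mul_one, tsum_gaussTerm_sub ha hb hea heb (by linarith)] at this
  simp only [hH, hV, Nat.cast_zero, add_zero, zero_add] at this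
  rw [show f - c = 1 + a + b - e by linear_combination h, mul_inv]
  have n1 := hc.Gamma_ne_zero
  have n2 := hce.Gamma_ne_zero
  have n3 := hfa.Gamma_ne_zero
  have n4 := hfb.Gamma_ne_zero
  rw [mul_div_assoc', div_eq_iff (by positivity)] at this
  field_simp at this ⊢
  linear_combination this

/-- Terms of the series `Fstar`. -/
def fstarTerm (a b c d e f g : ℂ) (k : ℕ) : ℂ :=
  (Gamma (k + a) * Gamma (k + b) * Gamma (k + c) * Gamma (k + d)) /
    ((k.factorial : ℂ) * Gamma (k + e) * Gamma (k + f) * Gamma (k + g))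

lemma tsum_fstarTerm (a b c d e f g : ℂ) :
    ∑' k, fstarTerm a b c d e f g k = Fstar a b c d e f g := rfl

lemma fstarTerm_eq (a b c d e f g : ℂ) (k : ℕ) : fstarTerm a b c d e f g k =
    gaussTerm a b e k * (Gamma (k + c) * Gamma (k + d) / (Gamma (k + f) * Gamma (k + g))) := by
  rw [fstarTerm, gaussTerm, div_mul_div_comm]
  congr 1 <;> ring

lemma summable_double {a b e B C D c F : ℂ} (h₁ : c - F = e - a - b - 1)
    (h₂ : c - F = D - B - C - 1) (hre : 1 ≤ (e - a - b).re) :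
    Summable (Function.uncurry fun k t : ℕ =>
      gaussTerm a b e k * saalTerm B C (c + k) D (F + k) t) := by
  obtain ⟨C₁, hC₁0, hC₁⟩ := gaussTerm_bound a b e
  obtain ⟨C₂, hC₂0, hC₂⟩ := gaussTerm_bound B C D
  obtain ⟨C₃, hC₃0, hC₃⟩ := Gamma_ratio_bound c F
  set p := (c - F).re with hp
  have hp0 : 0 ≤ p := by rw [hp, h₁]; simp at *; linarith
  have hp1 : (a + b - e).re - 1 + p = -2 := by rw [hp, h₁]; simp; ring
  have hp2 : (B + C - D).re - 1 + p = -2 := by rw [hp, h₂]; simp; ring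
  have hs : Summable fun n : ℕ => ((n : ℝ) + 1) ^ (-2 : ℝ) := summable_rpow_succ (by norm_num)
  refine .of_norm_bounded (g := fun x : ℕ × ℕ =>
    (C₁ * C₂ * C₃) * (((x.1 : ℝ) + 1) ^ (-2 : ℝ) * ((x.2 : ℝ) + 1) ^ (-2 : ℝ)))
    ((hs.mul_of_nonneg hs (fun _ => by positivity) fun _ => by positivity).mul_left _) ?_
  rintro ⟨k, t⟩
  have hk : (0 : ℝ) < (k : ℝ) + 1 := by positivity
  have ht : (0 : ℝ) < (t : ℝ) + 1 := by positivity
  have h1 := hC₃ (t + k)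
  rw [show ((t + k : ℕ) : ℂ) + c = t + (c + k) by push_cast; ring,
    show ((t + k : ℕ) : ℂ) + F = t + (F + k) by push_cast; ring] at h1
  have h3 : (((t + k : ℕ) : ℝ) + 1) ^ p ≤ ((k : ℝ) + 1) ^ p * ((t : ℝ) + 1) ^ p := by
    rw [← Real.mul_rpow hk.le ht.le]
    gcongr
    push_cast
    nlinarith [(by positivity : (0 : ℝ) ≤ k * t)]
  simp only [Function.uncurry_apply_pair]
  rw [saalTerm_eq, norm_mul, norm_mul]
  calc _ ≤ (C₁ * ((k : ℝ) + 1) ^ ((a + b - e).re - 1)) *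
        ((C₂ * ((t : ℝ) + 1) ^ ((B + C - D).re - 1)) *
          (C₃ * (((k : ℝ) + 1) ^ p * ((t : ℝ) + 1) ^ p))) := by
        gcongr
        exacts [hC₁ k, hC₂ t, h1.trans (by gcongr)]
    _ = C₁ * C₂ * C₃ * ((((k : ℝ) + 1) ^ ((a + b - e).re - 1) * ((k : ℝ) + 1) ^ p) *
          (((t : ℝ) + 1) ^ ((B + C - D).re - 1) * ((t : ℝ) + 1) ^ p)) := by ring
    _ = _ := by rw [← Real.rpow_add hk, ← Real.rpow_add ht, hp1, hp2]

lemma gaussTerm_mul_saalTerm_comm (a b e B C D c F : ℂ) (k t : ℕ) :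
    gaussTerm a b e k * saalTerm B C (c + k) D (F + k) t =
      gaussTerm B C D t * saalTerm a b (c + t) e (F + t) k := by
  rw [saalTerm_eq, saalTerm_eq, show (t : ℂ) + (c + k) = k + (c + t) by ring,
    show (t : ℂ) + (F + k) = k + (F + t) by ring]
  ring

lemma summable_gaussTerm_mul_tsum {a b e B C D c F : ℂ} (h₁ : c - F = e - a - b - 1)
    (h₂ : c - F = D - B - C - 1) (hre : 1 ≤ (e - a - b).re) :
    Summable fun k : ℕ => gaussTerm a b e k * ∑' t, saalTerm B C (c + k) D (F + k) t := by
  simpa only [Function.uncurry_apply_pair, tsum_mul_left] using (summable_double h₁ h₂ hre).prod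

lemma tsum_gaussTerm_mul_tsum_comm {a b e B C D c F : ℂ} (h₁ : c - F = e - a - b - 1)
    (h₂ : c - F = D - B - C - 1) (hre : 1 ≤ (e - a - b).re) :
    ∑' k : ℕ, gaussTerm a b e k * ∑' t, saalTerm B C (c + k) D (F + k) t =
      ∑' t : ℕ, gaussTerm B C D t * ∑' k, saalTerm a b (c + t) e (F + t) k := by
  simp only [← tsum_mul_left]
  rw [← (summable_double h₁ h₂ hre).tsum_comm]
  simp only [gaussTerm_mul_saalTerm_comm]

lemma Sn_one_add_sub (x y : ℂ) : Sn (1 + x - y) = Sn (y - x) := by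
  rw [Sn, Sn, ← Complex.sin_pi_sub]; congr 1; ring

lemma gamma_kernel {c d f g u : ℂ} (hc : NotInt c) (hd : NotInt d) (hf : NotInt f)
    (hg : NotInt g) (hgd : NotInt (g - d)) (hfd : NotInt (f - d)) (hgc : NotInt (g - c))
    (hfc : NotInt (f - c)) (hu : u = f + g - c - d) (hre : u.re ≤ 0) :
    ∑' t, saalTerm (g - d) (f - d) c (1 + c - d) (f + g - d) t -
        ∑' t, saalTerm (g - c) (f - c) d (1 + d - c) (f + g - c) t =
      Sn (d - c) / Real.pi * (Gamma (g - d) * Gamma (f - d) * Gamma (g - c) * Gamma (f - c)) *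
        (Gamma u)⁻¹ * (Gamma c * Gamma d / (Gamma f * Gamma g)) := by
  have := saalschutz (a := g - d) (b := f - d) (c := c) (e := 1 + c - d) (f := f + g - d)
    hgd hfd hc (hgc.of_eq_sub 1 (by push_cast; ring)) (hfc.of_eq_sub 1 (by push_cast; ring))
    (hd.of_eq_sub 1 (by push_cast; ring)) (hf.of_eq_add 0 (by push_cast; ring))
    (hg.of_eq_add 0 (by push_cast; ring)) (by ring)
    (by rw [show 1 + c - d - (g - d) - (f - d) = 1 - u by rw [hu]; ring]; simpa using hre)
  rw [show 1 + (g - d) - (1 + c - d) = g - c by ring,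
    show 1 + (f - d) - (1 + c - d) = f - c by ring,
    show 1 + c - (1 + c - d) = d by ring, show 2 - (1 + c - d) = 1 + d - c by ring,
    show 1 + (f + g - d) - (1 + c - d) = f + g - c by ring, show f + g - d - (g - d) = f by ring,
    show f + g - d - (f - d) = g by ring, show f + g - d - c = u by rw [hu]; ring,
    Sn_one_add_sub] at this
  rw [this, mul_inv, mul_inv, div_eq_mul_inv (Gamma c * Gamma d), mul_inv]
  ring

/-- A two-term transformation of differences of Saalschützian series, in the region where both
intermediate double series converge. -/
theorem sears_transformation {a b c d e f g : ℂ} (h : e + f + g = a + b + c + d + 1)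
    (hre : 1 ≤ (e - a - b).re) (ha : NotInt a) (hb : NotInt b) (hc : NotInt c) (hd : NotInt d)
    (hf : NotInt f) (hg : NotInt g)
    (hea : NotInt (e - a)) (heb : NotInt (e - b)) (hec : NotInt (e - c)) (hed : NotInt (e - d))
    (hef : NotInt (e - f)) (heg : NotInt (e - g)) (hgd : NotInt (g - d)) (hfd : NotInt (f - d))
    (hgc : NotInt (g - c)) (hfc : NotInt (f - c)) (hcd : NotInt (d - c))
    (hda : NotInt (f + g - d - a)) (hdb : NotInt (f + g - d - b))
    (hca : NotInt (f + g - c - a)) (hcb : NotInt (f + g - c - b)) (hu : NotInt (e - a - b)) :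
    Fstar a b c d e f g -
        Fstar (1 + a - e) (1 + b - e) (1 + c - e) (1 + d - e) (2 - e) (1 + f - e) (1 + g - e) =
      Sn e / Sn (d - c) * (Gamma a * Gamma b * (Gamma (1 + a - e) * Gamma (1 + b - e))) *
        (Gamma (g - d) * Gamma (f - d) * Gamma (g - c) * Gamma (f - c))⁻¹ *
        (Fstar c (1 + c - e) (g - d) (f - d) (1 + c - d) (f + g - d - a) (f + g - d - b) -
          Fstar d (1 + d - e) (g - c) (f - c) (1 + d - c) (f + g - c - a) (f + g - c - b)) := by
  set P := Sn (d - c) / Real.pi * (Gamma (g - d) * Gamma (f - d) * Gamma (g - c) * Gamma (f - c)) *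
    (Gamma (f + g - c - d))⁻¹ with hP
  set Q := Sn e / Real.pi * (Gamma a * Gamma b * (Gamma (1 + a - e) * Gamma (1 + b - e))) *
    (Gamma (f + g - c - d))⁻¹ with hQ
  have hu' : (f + g - c - d).re ≤ 0 := by
    rw [show f + g - c - d = 1 - (e - a - b) by linear_combination h, sub_re, one_re]; linarith
  have expand : ∀ {a' b' c' d' e' f' g' : ℂ}, e' + f' + g' = a' + b' + c' + d' + 1 →
      1 ≤ (e' - a' - b').re → NotInt c' → NotInt d' → NotInt f' → NotInt g' →
      g' - d' = g - d → f' - d' = f - d → g' - c' = g - c → f' - c' = f - c → d' - c' = d - c →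
      P * Fstar a' b' c' d' e' f' g' =
        ∑' t : ℕ, gaussTerm (g - d) (f - d) (1 + c - d) t *
          ∑' k, saalTerm a' b' (c' + t) e' (f' + g' - d' + t) k -
        ∑' t : ℕ, gaussTerm (g - c) (f - c) (1 + d - c) t *
          ∑' k, saalTerm a' b' (d' + t) e' (f' + g' - c' + t) k := by
    intro a' b' c' d' e' f' g' h' hre' hc' hd' hf' hg' e1 e2 e3 e4 e5
    have c1 : c' - (f' + g' - d') = e' - a' - b' - 1 := by linear_combination -h'
    have c2 : c' - (f' + g' - d') = (1 + c - d) - (g - d) - (f - d) - 1 := by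
      linear_combination -e1 - e4
    have c3 : d' - (f' + g' - c') = e' - a' - b' - 1 := by linear_combination -h'
    have c4 : d' - (f' + g' - c') = (1 + d - c) - (g - c) - (f - c) - 1 := by
      linear_combination -e3 - e2
    rw [← tsum_gaussTerm_mul_tsum_comm c1 c2 hre', ← tsum_gaussTerm_mul_tsum_comm c3 c4 hre',
      ← (summable_gaussTerm_mul_tsum c1 c2 hre').tsum_sub
        (summable_gaussTerm_mul_tsum c3 c4 hre'), ← tsum_fstarTerm, ← tsum_mul_left]
    refine tsum_congr fun k => ?_
    have := gamma_kernel (c := c' + k) (d := d' + k) (f := f' + k) (g := g' + k)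
      (u := f + g - c - d)
      (hc'.of_eq_add k (by push_cast; ring)) (hd'.of_eq_add k (by push_cast; ring))
      (hf'.of_eq_add k (by push_cast; ring)) (hg'.of_eq_add k (by push_cast; ring))
      (hgd.of_eq_add 0 (by push_cast; linear_combination e1))
      (hfd.of_eq_add 0 (by push_cast; linear_combination e2))
      (hgc.of_eq_add 0 (by push_cast; linear_combination e3))
      (hfc.of_eq_add 0 (by push_cast; linear_combination e4)) (by linear_combination -e1 - e4) hu'
    rw [show g' + k - (d' + k) = g - d by linear_combination e1,
      show f' + k - (d' + k) = f - d by linear_combination e2,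
      show g' + k - (c' + k) = g - c by linear_combination e3,
      show f' + k - (c' + k) = f - c by linear_combination e4,
      show d' + k - (c' + k) = d - c by linear_combination e5,
      show 1 + (c' + k) - (d' + k) = 1 + c - d by linear_combination -e5,
      show 1 + (d' + k) - (c' + k) = 1 + d - c by linear_combination e5,
      show f' + k + (g' + k) - (d' + k) = f' + g' - d' + k by ring,
      show f' + k + (g' + k) - (c' + k) = f' + g' - c' + k by ring] at this
    rw [← mul_sub, this, fstarTerm_eq, hP, add_comm c', add_comm d', add_comm f', add_comm g']
    ring
  have collapse : ∀ {c' d' B C D : ℂ}, NotInt c' → NotInt (e - c') → NotInt (f + g - d' - a) →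
      NotInt (f + g - d' - b) → c' + d' = c + d → c' - (f + g - d') = D - B - C - 1 →
      ∑' t : ℕ, gaussTerm B C D t * ∑' k, saalTerm a b (c' + t) e (f + g - d' + t) k -
      ∑' t : ℕ, gaussTerm B C D t * ∑' k, saalTerm (1 + a - e) (1 + b - e) (1 + c' - e + t) (2 - e)
        (1 + f - e + (1 + g - e) - (1 + d' - e) + t) k =
      Q * Fstar c' (1 + c' - e) B C D (f + g - d' - a) (f + g - d' - b) := by
    intro c' d' B C D hc' hec' hda' hdb' e1 e2
    have c1 : c' - (f + g - d') = e - a - b - 1 := by linear_combination e1 - h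
    have c3 : (1 + c' - e) - (1 + f - e + (1 + g - e) - (1 + d' - e)) =
      (2 - e) - (1 + a - e) - (1 + b - e) - 1 := by linear_combination e1 - h
    have c4 : (1 + c' - e) - (1 + f - e + (1 + g - e) - (1 + d' - e)) =
      D - B - C - 1 := by linear_combination e2
    have hD : D - B - C = e - a - b := by linear_combination c1 - e2
    have hre' : 1 ≤ (D - B - C).re := by rwa [hD]
    rw [← (summable_gaussTerm_mul_tsum e2 c1 hre').tsum_sub
      (summable_gaussTerm_mul_tsum c4 c3 hre'), ← tsum_fstarTerm, ← tsum_mul_left]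
    refine tsum_congr fun t => ?_
    have := saalschutz (a := a) (b := b) (c := c' + t) (e := e) (f := f + g - d' + t) ha hb
      (hc'.of_eq_add t (by push_cast; ring)) hea heb (hec'.of_eq_add (-t) (by push_cast; ring))
      (hda'.of_eq_add t (by push_cast; ring)) (hdb'.of_eq_add t (by push_cast; ring))
      (by linear_combination h - e1) hre
    rw [show 1 + (c' + t) - e = 1 + c' - e + t by ring,
      show 1 + (f + g - d' + t) - e = 1 + f - e + (1 + g - e) - (1 + d' - e) + t by ring,
      show f + g - d' + t - (c' + t) = f + g - c - d by linear_combination -e1] at this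
    rw [← mul_sub, this, fstarTerm, gaussTerm, hQ,
      show f + g - d' + t - a = t + (f + g - d' - a) by ring,
      show f + g - d' + t - b = t + (f + g - d' - b) by ring, add_comm c', add_comm (1 + c' - e)]
    simp only [div_eq_mul_inv, mul_inv]
    ring
  have x1 := expand h hre hc hd hf hg rfl rfl rfl rfl rfl
  have x2 := expand (a' := 1 + a - e) (b' := 1 + b - e) (c' := 1 + c - e) (d' := 1 + d - e)
    (e' := 2 - e) (f' := 1 + f - e) (g' := 1 + g - e) (by linear_combination h)
    (by rwa [show 2 - e - (1 + a - e) - (1 + b - e) = e - a - b by ring])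
    (hec.of_eq_sub 1 (by push_cast; ring)) (hed.of_eq_sub 1 (by push_cast; ring))
    (hef.of_eq_sub 1 (by push_cast; ring)) (heg.of_eq_sub 1 (by push_cast; ring))
    (by ring) (by ring) (by ring) (by ring) (by ring)
  have x3 := collapse (c' := c) (d' := d) (B := g - d) (C := f - d) (D := 1 + c - d) hc hec hda hdb
    rfl (by ring)
  have x4 := collapse (c' := d) (d' := c) (B := g - c) (C := f - c) (D := 1 + d - c) hd hed hca hcb
    (by ring) (by ring)
  have n0 : Gamma (f + g - c - d) ≠ 0 :=
    (hu.of_eq_sub 1 (by push_cast; linear_combination h)).Gamma_ne_zero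
  have n1 := hcd.Sn_ne_zero
  have n2 := hgd.Gamma_ne_zero
  have n3 := hfd.Gamma_ne_zero
  have n4 := hgc.Gamma_ne_zero
  have n5 := hfc.Gamma_ne_zero
  have hpi : (Real.pi : ℂ) ≠ 0 := by exact_mod_cast Real.pi_ne_zero
  have hP0 : P ≠ 0 := by rw [hP]; positivity
  refine mul_left_cancel₀ hP0 ?_
  rw [mul_sub, x1, x2]
  have hPQ : P * (Sn e / Sn (d - c) *
        (Gamma a * Gamma b * (Gamma (1 + a - e) * Gamma (1 + b - e))) *
        (Gamma (g - d) * Gamma (f - d) * Gamma (g - c) * Gamma (f - c))⁻¹) = Q := by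
    rw [hP, hQ]; field_simp
  rw [← mul_assoc, hPQ]
  linear_combination x3 - x4

lemma summable_fstarTerm {a b c d e f g : ℂ} (h : e + f + g = a + b + c + d + 1) :
    Summable (fstarTerm a b c d e f g) := by
  obtain ⟨C, -, hC⟩ := Gamma_ratio_bound_four a 1 b e c f d g
  refine summable_of_rpow_bound (C := C) (p := (-2 : ℝ)) (by norm_num) fun n => ?_
  have := hC n
  rw [show a - 1 + (b - e) + (c - f + (d - g)) = -2 by linear_combination -h] at this
  convert this using 2
  · rw [fstarTerm, Gamma_nat_eq_factorial]
    simp only [div_eq_mul_inv, mul_inv]; ring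
  · simp

lemma fstarTerm_succ {a b c d : ℂ} (ha : Gamma a ≠ 0) (hb : Gamma b ≠ 0) (hc : Gamma c ≠ 0)
    (hd : Gamma d ≠ 0) (e f g : ℂ) (k : ℕ) :
    (k + 1) * fstarTerm a b c d e f g (k + 1) * ((k + e) * (k + f) * (k + g)) =
      (k + a) * (k + b) * (k + c) * (k + d) * fstarTerm a b c d e f g k := by
  have e1 := inv_Gamma_rec (k + e)
  have e2 := inv_Gamma_rec (k + f)
  have e3 := inv_Gamma_rec (k + g)
  have hfac : (k.factorial : ℂ) ≠ 0 := by exact_mod_cast k.factorial_ne_zero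
  have hk : (k : ℂ) + 1 ≠ 0 := by exact_mod_cast Nat.succ_ne_zero k
  simp only [fstarTerm, Gamma_nat_succ_add ha, Gamma_nat_succ_add hb, Gamma_nat_succ_add hc,
    Gamma_nat_succ_add hd, Nat.factorial_succ]
  rw [show ((k + 1 : ℕ) : ℂ) + e = k + e + 1 by push_cast; ring,
    show ((k + 1 : ℕ) : ℂ) + f = k + f + 1 by push_cast; ring,
    show ((k + 1 : ℕ) : ℂ) + g = k + g + 1 by push_cast; ring]
  push_cast
  simp only [div_eq_mul_inv, mul_inv, e1, e2, e3]
  field_simp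
  ring

/-- A quantitative bound for the tail of a sequence satisfying the recursion of a Saalschützian
series. -/
lemma norm_le_of_recursion {T : ℕ → ℂ} {u v : ℕ → ℂ} {C : ℝ} {N : ℕ} (hN : 0 < N)
    (hrec : ∀ k, N ≤ k → (k + 1) * T (k + 1) * v k = u k * T k)
    (hv : ∀ k, N ≤ k → (k : ℝ) ^ 3 / 8 ≤ ‖v k‖)
    (huv : ∀ k, N ≤ k → ‖(k + 1) * u k - k ^ 2 * v k‖ ≤ C * (k : ℝ) ^ 3) (hC : 0 ≤ C) (m : ℕ) :
    ‖T (N + m)‖ ≤ (N : ℝ) ^ 2 * ‖T N‖ * Real.exp (16 * C) * ((N + m : ℕ) : ℝ) ^ (-2 : ℝ) := by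
  have hN1 : (1 : ℝ) ≤ N := by exact_mod_cast hN
  have hbound : ((N + m : ℕ) : ℝ) ^ 2 * ‖T (N + m)‖ ≤
      (N : ℝ) ^ 2 * ‖T N‖ * Real.exp (16 * C * (1 / N - 1 / (N + m : ℕ))) := by
    induction m with
    | zero => simp
    | succ m ih =>
      rw [← add_assoc]
      set k := N + m with hk
      have hNk : N ≤ k := by omega
      have hk1 : (1 : ℝ) ≤ k := hN1.trans (by exact_mod_cast hNk)
      have hk0 : (0 : ℝ) < k := by linarith
      have h1 : ‖((k : ℂ) + 1) ^ 2 * T (k + 1)‖ * ‖(k : ℂ) ^ 2 * v k‖ ≤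
          (‖(k : ℂ) ^ 2 * v k‖ + C * (k : ℝ) ^ 3) * ‖(k : ℂ) ^ 2 * T k‖ := by
        rw [← norm_mul, show ((k : ℂ) + 1) ^ 2 * T (k + 1) * ((k : ℂ) ^ 2 * v k) =
          ((k : ℂ) ^ 2 * v k + ((k + 1) * u k - (k : ℂ) ^ 2 * v k)) * ((k : ℂ) ^ 2 * T k) by
          linear_combination ((k : ℂ) + 1) * k ^ 2 * hrec k hNk, norm_mul]
        gcongr
        exact (norm_add_le _ _).trans (by gcongr; exact huv k hNk)
      have h2 : (k : ℝ) ^ 5 / 8 ≤ ‖(k : ℂ) ^ 2 * v k‖ := by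
        rw [norm_mul, norm_pow, Complex.norm_natCast]
        calc _ = (k : ℝ) ^ 2 * ((k : ℝ) ^ 3 / 8) := by ring
          _ ≤ _ := by gcongr; exact hv k hNk
      have h3 : 0 < ‖(k : ℂ) ^ 2 * v k‖ := lt_of_lt_of_le (by positivity) h2
      have h4 : ‖((k : ℂ) + 1) ^ 2 * T (k + 1)‖ ≤
          (1 + 8 * C / (k : ℝ) ^ 2) * ‖(k : ℂ) ^ 2 * T k‖ := by
        rw [← mul_le_mul_iff_left₀ h3]
        refine h1.trans ?_
        rw [mul_right_comm]
        have h7 : C * (k : ℝ) ^ 3 ≤ 8 * C / (k : ℝ) ^ 2 * ‖(k : ℂ) ^ 2 * v k‖ := by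
          calc C * (k : ℝ) ^ 3 = 8 * C / (k : ℝ) ^ 2 * ((k : ℝ) ^ 5 / 8) := by field_simp
            _ ≤ _ := by gcongr
        exact mul_le_mul_of_nonneg_right (by linarith) (norm_nonneg _)
      have h5 : 1 + 8 * C / (k : ℝ) ^ 2 ≤ Real.exp (16 * C * (1 / k - 1 / (k + 1 : ℕ))) := by
        refine (add_comm _ _).trans_le ((Real.add_one_le_exp _).trans (Real.exp_le_exp.mpr ?_))
        have : 1 / (k : ℝ) ^ 2 ≤ 2 * (1 / k - 1 / (k + 1 : ℕ)) := by
          push_cast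
          rw [div_sub_div _ _ hk0.ne' (by positivity), mul_div_assoc',
            div_le_div_iff₀ (by positivity) (by positivity)]
          nlinarith
        calc 8 * C / (k : ℝ) ^ 2 = 8 * C * (1 / (k : ℝ) ^ 2) := by ring
          _ ≤ 8 * C * (2 * (1 / k - 1 / (k + 1 : ℕ))) := by gcongr
          _ = _ := by ring
      have h6 : ‖((k : ℂ) + 1) ^ 2 * T (k + 1)‖ = ((k + 1 : ℕ) : ℝ) ^ 2 * ‖T (k + 1)‖ := by
        rw [norm_mul, norm_pow, ← Nat.cast_succ, Complex.norm_natCast]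
      rw [h6, norm_mul, norm_pow, Complex.norm_natCast] at h4
      calc _ ≤ _ := h4
        _ ≤ Real.exp (16 * C * (1 / k - 1 / (k + 1 : ℕ))) *
            ((N : ℝ) ^ 2 * ‖T N‖ * Real.exp (16 * C * (1 / N - 1 / k))) := by gcongr
        _ = (N : ℝ) ^ 2 * ‖T N‖ * (Real.exp (16 * C * (1 / k - 1 / (k + 1 : ℕ))) *
            Real.exp (16 * C * (1 / N - 1 / k))) := by ring
        _ = _ := by rw [← Real.exp_add]; ring_nf
  have hp : (0 : ℝ) < ((N + m : ℕ) : ℝ) := by positivity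
  rw [Real.rpow_neg hp.le, ← div_eq_mul_inv, le_div_iff₀ (by positivity), mul_comm]
  norm_cast at hbound ⊢
  refine hbound.trans (mul_le_mul_of_nonneg_left (Real.exp_le_exp.mpr ?_) (by positivity))
  have h1 : 1 / (N : ℝ) ≤ 1 := by rw [div_le_one (by positivity)]; exact hN1
  have h2 : 0 ≤ 1 / ((N + m : ℕ) : ℝ) := by positivity
  calc 16 * C * (1 / (N : ℝ) - 1 / (N + m : ℕ)) ≤ 16 * C * 1 := by gcongr; linarith
    _ = _ := mul_one _

lemma eventually_norm_le {φ : ℂ → ℂ} {z₀ : ℂ} (h : ContinuousAt φ z₀) :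
    ∀ᶠ z in 𝓝 z₀, ‖φ z‖ ≤ ‖φ z₀‖ + 1 :=
  (h.norm.tendsto.eventually_lt_const (lt_add_one _)).mono fun _ h => h.le

lemma eventually_Gamma_ne_zero {φ : ℂ → ℂ} {z₀ : ℂ} (h : ContinuousAt φ z₀)
    (h0 : Gamma (φ z₀) ≠ 0) : ∀ᶠ z in 𝓝 z₀, Gamma (φ z) ≠ 0 :=
  ContinuousAt.eventually_ne (ContinuousAt.comp
    (differentiableAt_Gamma _ (Gamma_ne_zero_iff.mp h0)).continuousAt h) h0

lemma differentiableAt_inv_Gamma_comp {φ : ℂ → ℂ} {z : ℂ} (h : DifferentiableAt ℂ φ z) :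
    DifferentiableAt ℂ (fun z => (Gamma (φ z))⁻¹) z :=
  DifferentiableAt.comp (g := fun s => (Gamma s)⁻¹) z (differentiable_one_div_Gamma (φ z)) h

lemma differentiableAt_Gamma_comp {φ : ℂ → ℂ} {z : ℂ} (h : DifferentiableAt ℂ φ z)
    (h0 : Gamma (φ z) ≠ 0) : DifferentiableAt ℂ (fun z => Gamma (φ z)) z :=
  DifferentiableAt.comp z (differentiableAt_Gamma _ (Gamma_ne_zero_iff.mp h0)) h

lemma differentiableAt_fstarTerm {a b c d e f g : ℂ → ℂ} (ha : Differentiable ℂ a)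
    (hb : Differentiable ℂ b) (hc : Differentiable ℂ c) (hd : Differentiable ℂ d)
    (he : Differentiable ℂ e) (hf : Differentiable ℂ f) (hg : Differentiable ℂ g)
    {z : ℂ} (ha0 : Gamma (a z) ≠ 0) (hb0 : Gamma (b z) ≠ 0)
    (hc0 : Gamma (c z) ≠ 0) (hd0 : Gamma (d z) ≠ 0) (k : ℕ) :
    DifferentiableAt ℂ (fun z => fstarTerm (a z) (b z) (c z) (d z) (e z) (f z) (g z) k) z := by
  have num : ∀ {φ : ℂ → ℂ}, Differentiable ℂ φ → Gamma (φ z) ≠ 0 →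
      DifferentiableAt ℂ (fun z => Gamma (k + φ z)) z := fun hφ h0 =>
    differentiableAt_Gamma_comp ((hφ z).const_add _)
      (by rw [add_comm]; exact Gamma_add_nat_ne_zero h0 k)
  have den : ∀ {φ : ℂ → ℂ}, Differentiable ℂ φ →
      DifferentiableAt ℂ (fun z => (Gamma (k + φ z))⁻¹) z := fun hφ =>
    differentiableAt_inv_Gamma_comp ((hφ z).const_add _)
  simp only [fstarTerm, div_eq_mul_inv, mul_inv]
  exact ((((num ha ha0).mul (num hb hb0)).mul (num hc hc0)).mul (num hd hd0)).mul
    ((((differentiableAt_const _).mul (den he)).mul (den hf)).mul (den hg))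

lemma differentiableAt_Fstar {a b c d e f g : ℂ → ℂ} (ha : Differentiable ℂ a)
    (hb : Differentiable ℂ b) (hc : Differentiable ℂ c) (hd : Differentiable ℂ d)
    (he : Differentiable ℂ e) (hf : Differentiable ℂ f) (hg : Differentiable ℂ g)
    (h : ∀ z, e z + f z + g z = a z + b z + c z + d z + 1) {z₀ : ℂ}
    (ha0 : Gamma (a z₀) ≠ 0) (hb0 : Gamma (b z₀) ≠ 0)
    (hc0 : Gamma (c z₀) ≠ 0) (hd0 : Gamma (d z₀) ≠ 0) :
    DifferentiableAt ℂ (fun z => Fstar (a z) (b z) (c z) (d z) (e z) (f z) (g z)) z₀ := by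
  have ca := ha.continuous
  have cb := hb.continuous
  have cc := hc.continuous
  have cd := hd.continuous
  have ce := he.continuous
  have cf := hf.continuous
  have cg := hg.continuous
  obtain ⟨N, hN⟩ := exists_nat_gt (2 * ((‖e z₀‖ + 1) + (‖f z₀‖ + 1) + (‖g z₀‖ + 1)))
  have hN0 : 0 < N := by
    have : (0 : ℝ) < N := lt_of_le_of_lt (by positivity) hN
    exact_mod_cast this
  set T : ℕ → ℂ → ℂ := fun k z => fstarTerm (a z) (b z) (c z) (d z) (e z) (f z) (g z) k with hT
  set c₃ : ℂ → ℂ := fun z =>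
    (a z * b z + a z * c z + a z * d z + b z * c z + b z * d z + c z * d z) +
    (a z + b z + c z + d z) - (e z * f z + e z * g z + f z * g z) with hc₃
  set c₂ : ℂ → ℂ := fun z =>
    (a z * b z * c z + a z * b z * d z + a z * c z * d z + b z * c z * d z) +
    (a z * b z + a z * c z + a z * d z + b z * c z + b z * d z + c z * d z) -
    e z * f z * g z with hc₂
  set c₁ : ℂ → ℂ := fun z => a z * b z * c z * d z +
    (a z * b z * c z + a z * b z * d z + a z * c z * d z + b z * c z * d z) with hc₁
  set c₀ : ℂ → ℂ := fun z => a z * b z * c z * d z with hc₀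
  have ev := ((eventually_Gamma_ne_zero ca.continuousAt ha0).and <|
    (eventually_Gamma_ne_zero cb.continuousAt hb0).and <|
    (eventually_Gamma_ne_zero cc.continuousAt hc0).and <|
    (eventually_Gamma_ne_zero cd.continuousAt hd0).and <|
    (eventually_norm_le ce.continuousAt).and <| (eventually_norm_le cf.continuousAt).and <|
    (eventually_norm_le cg.continuousAt).and <|
    (eventually_norm_le (φ := c₃) (z₀ := z₀) (by fun_prop)).and <|
    (eventually_norm_le (φ := c₂) (z₀ := z₀) (by fun_prop)).and <|
    (eventually_norm_le (φ := c₁) (z₀ := z₀) (by fun_prop)).and <|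
    (eventually_norm_le (φ := c₀) (z₀ := z₀) (by fun_prop)).and <|
    eventually_norm_le (φ := T N) (z₀ := z₀)
      (differentiableAt_fstarTerm ha hb hc hd he hf hg ha0 hb0 hc0 hd0 N).continuousAt)
  obtain ⟨V, hV, hVo, hz₀⟩ := eventually_nhds_iff.mp ev
  set C : ℝ := (‖c₃ z₀‖ + 1) + (‖c₂ z₀‖ + 1) + (‖c₁ z₀‖ + 1) + (‖c₀ z₀‖ + 1) with hC
  have bound : ∀ m : ℕ, ∀ z ∈ V, ‖T (N + m) z‖ ≤
      ((N : ℝ) ^ 2 * (‖T N z₀‖ + 1) * Real.exp (16 * C)) * ((m : ℝ) + 1) ^ (-2 : ℝ) := by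
    intro m z hz
    obtain ⟨h1, h2, h3, h4, h5, h6, h7, h8, h9, h10, h11, h12⟩ := hV z hz
    have hbase : ∀ k, N ≤ k → ∀ w : ℂ, 2 * ‖w‖ ≤ N → (k : ℝ) / 2 ≤ ‖(k : ℂ) + w‖ := by
      intro k hk w hw
      have hk' : (N : ℝ) ≤ k := by exact_mod_cast hk
      have := norm_sub_norm_le (k : ℂ) (-w)
      rw [sub_neg_eq_add, norm_neg, Complex.norm_natCast] at this
      linarith
    have key := norm_le_of_recursion (T := fun k => T k z) (N := N) (C := C)
      (u := fun k => (k + a z) * (k + b z) * (k + c z) * (k + d z))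
      (v := fun k => (k + e z) * (k + f z) * (k + g z)) hN0
      (fun k _ => fstarTerm_succ h1 h2 h3 h4 _ _ _ k)
      (fun k hk => by
        rw [norm_mul, norm_mul]
        calc (k : ℝ) ^ 3 / 8 = k / 2 * (k / 2) * (k / 2) := by ring
          _ ≤ _ := by
            gcongr
            all_goals
              refine hbase k hk _ ?_
              linarith [norm_nonneg (e z₀), norm_nonneg (f z₀), norm_nonneg (g z₀)])
      (fun k hk => by
        have hk1 : (1 : ℝ) ≤ k := by exact_mod_cast hN0.trans_le hk
        rw [show ((k : ℂ) + 1) * ((k + a z) * (k + b z) * (k + c z) * (k + d z)) -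
          k ^ 2 * ((k + e z) * (k + f z) * (k + g z)) =
          c₃ z * k ^ 3 + c₂ z * k ^ 2 + c₁ z * k + c₀ z by
          simp only [hc₃, hc₂, hc₁, hc₀]; linear_combination (-(k : ℂ) ^ 4) * h z]
        have hk2 : (k : ℝ) ^ 2 ≤ (k : ℝ) ^ 3 := pow_le_pow_right₀ hk1 (by norm_num)
        have hk3 : (k : ℝ) ≤ (k : ℝ) ^ 3 := le_self_pow₀ hk1 (by norm_num)
        have hk4 : 1 ≤ (k : ℝ) ^ 3 := one_le_pow₀ hk1
        calc _ ≤ ‖c₃ z * k ^ 3‖ + ‖c₂ z * k ^ 2‖ + ‖c₁ z * k‖ + ‖c₀ z‖ := norm_add₄_le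
          _ = ‖c₃ z‖ * k ^ 3 + ‖c₂ z‖ * k ^ 2 + ‖c₁ z‖ * k + ‖c₀ z‖ * 1 := by
            simp only [norm_mul, norm_pow, Complex.norm_natCast, mul_one]
          _ ≤ (‖c₃ z₀‖ + 1) * k ^ 3 + (‖c₂ z₀‖ + 1) * k ^ 3 + (‖c₁ z₀‖ + 1) * k ^ 3 +
              (‖c₀ z₀‖ + 1) * k ^ 3 := by gcongr
          _ = _ := by rw [hC]; ring) (by positivity) m
    refine key.trans ?_
    gcongr ?_ * ?_
    · gcongr
    · refine Real.rpow_le_rpow_of_nonpos (by positivity) ?_ (by norm_num)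
      have : (1 : ℝ) ≤ N := by exact_mod_cast hN0
      push_cast; linarith
  have hdiff : ∀ k, ∀ z ∈ V, DifferentiableAt ℂ (T k) z := fun k z hz => by
    obtain ⟨h1, h2, h3, h4, -⟩ := hV z hz
    exact differentiableAt_fstarTerm ha hb hc hd he hf hg h1 h2 h3 h4 k
  have tail : DifferentiableAt ℂ (fun z => ∑' m, T (N + m) z) z₀ :=
    (differentiableOn_tsum_of_summable_norm ((summable_rpow_succ (by norm_num)).mul_left _)
      (fun m z hz => (hdiff _ z hz).differentiableWithinAt) hVo bound).differentiableAt
      (hVo.mem_nhds hz₀)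
  have split : (fun z => Fstar (a z) (b z) (c z) (d z) (e z) (f z) (g z)) =
      fun z => ∑ k ∈ Finset.range N, T k z + ∑' m, T (N + m) z := by
    funext z
    rw [← tsum_fstarTerm, ← (summable_fstarTerm (h z)).sum_add_tsum_nat_add N]
    simp only [hT, add_comm N]
  rw [split]
  exact (DifferentiableAt.fun_sum fun k _ => hdiff k z₀ hz₀).add tail

/-- No entry and no difference of two entries of `v` is an integer. -/
def Generic (v : Fin 7 → ℂ) : Prop :=
  (∀ i, NotInt (v i)) ∧ ∀ i j, i ≠ j → NotInt (v i - v j)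

lemma countable_compl_notInt {p q : ℂ} (h : q ≠ 0 ∨ NotInt p) :
    {z : ℂ | NotInt (p + z * q)}ᶜ.Countable := by
  by_cases hq : q = 0
  · subst hq
    have hp : NotInt p := by simpa using h
    simp [hp]
  · refine (Set.countable_range fun n : ℤ => ((n : ℂ) - p) / q).mono fun z hz => ?_
    obtain ⟨n, hn⟩ : ∃ n : ℤ, p + z * q = n := by simpa [NotInt] using hz
    exact ⟨n, by field_simp; linear_combination -hn⟩

lemma isOpen_notInt (p q : ℂ) : IsOpen {z : ℂ | NotInt (p + z * q)} := by
  have : {z : ℂ | NotInt (p + z * q)} =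
      (fun z => p + z * q) ⁻¹' (Set.range ((↑) : ℤ → ℂ))ᶜ := by
    ext z; simp [NotInt, eq_comm]
  rw [this]
  exact Complex.isOpen_compl_range_intCast.preimage (by fun_prop)

/-- The line `z ↦ v + z w` meets the generic set in a connected open set. -/
lemma isOpen_generic (v w : Fin 7 → ℂ) : IsOpen {z : ℂ | Generic fun i => v i + z * w i} := by
  simp only [Generic, Set.ofPred_and, Set.ofPred_forall, add_sub_add_comm, ← mul_sub]
  exact (isOpen_iInter_of_finite fun _ => isOpen_notInt _ _).inter
    (isOpen_iInter_of_finite fun _ => isOpen_iInter_of_finite fun _ =>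
      isOpen_iInter_of_finite fun _ => isOpen_notInt _ _)

lemma countable_compl_generic {v : Fin 7 → ℂ} (hv : Generic v) (w : Fin 7 → ℂ) :
    {z : ℂ | Generic fun i => v i + z * w i}ᶜ.Countable := by
  simp only [Generic, Set.ofPred_and, Set.ofPred_forall, add_sub_add_comm, ← mul_sub,
    Set.compl_inter, Set.compl_iInter]
  exact (Set.countable_iUnion fun i => countable_compl_notInt (.inr (hv.1 i))).union
    (Set.countable_iUnion fun i => Set.countable_iUnion fun j => Set.countable_iUnion fun hij =>
      countable_compl_notInt (.inr (hv.2 i j hij)))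

/-- Analytic continuation along a line through a generic point. -/
lemma eq_zero_of_generic_line {v w : Fin 7 → ℂ} (hv : Generic v) {Φ : ℂ → ℂ} {W E : Set ℂ}
    (hΦ : ∀ z, Generic (fun i => v i + z * w i) → DifferentiableAt ℂ Φ z)
    (hW : IsOpen W) (hW0 : W.Nonempty) (hE : E.Countable)
    (h : ∀ z ∈ W, z ∉ E → Generic (fun i => v i + z * w i) → Φ z = 0) : Φ 0 = 0 := by
  set U : Set ℂ := {z | Generic fun i => v i + z * w i} with hU
  have hUo : IsOpen U := isOpen_generic v w
  have hUc := countable_compl_generic hv w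
  have hconn : IsPreconnected U := by
    have := hUc.isConnected_compl_of_one_lt_rank (by simp)
    rw [compl_compl] at this
    exact this.isPreconnected
  have han : AnalyticOnNhd ℂ Φ U :=
    DifferentiableOn.analyticOnNhd (fun z hz => (hΦ z hz).differentiableWithinAt) hUo
  obtain ⟨z₀, hz₀W, hz₀U⟩ : (W ∩ U).Nonempty := by
    have := hUc.dense_compl ℂ
    rw [compl_compl] at this
    exact this.inter_open_nonempty W hW hW0
  have hfreq : ∀ᶠ z in 𝓝 z₀, Φ z = 0 := by
    have hcl : Dense (Eᶜ) := hE.dense_compl ℂ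
    filter_upwards [(hW.inter hUo).mem_nhds ⟨hz₀W, hz₀U⟩] with z hz
    have hcont : ContinuousAt Φ z := (hΦ z hz.2).continuousAt
    by_contra hne
    obtain ⟨V, hV, hVo, hzV⟩ := eventually_nhds_iff.mp
      ((hcont.eventually_ne hne).and ((hW.inter hUo).mem_nhds hz))
    obtain ⟨y, hyV, hyE⟩ := hcl.inter_open_nonempty V hVo ⟨z, hzV⟩
    exact (hV y hyV).1 (h y (hV y hyV).2.1 hyE (hV y hyV).2.2)
  have h0 : (0 : ℂ) ∈ U := by simpa [hU] using hv
  exact han.eqOn_zero_of_preconnected_of_eventuallyEq_zero hconn hz₀U hfreq h0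

lemma differentiable_Sn : Differentiable ℂ Sn := by
  unfold Sn; fun_prop

lemma Fstar_swap_upper (a b c d e f g : ℂ) : Fstar a b c d e f g = Fstar a b d c e f g := by
  simp only [Fstar, mul_right_comm]

lemma Fstar_reverse_upper (a b c d e f g : ℂ) : Fstar a b c d e f g = Fstar d c b a e f g := by
  unfold Fstar; congr 1; funext k; congr 1; ring

lemma Fstar_rotate_lower (a b c d e f g : ℂ) : Fstar a b c d e f g = Fstar a b c d g f e := by
  unfold Fstar; congr 1; funext k; congr 1; ring

lemma Fstar_swap_lower (a b c d e f g : ℂ) : Fstar a b c d e f g = Fstar a b c d e g f := by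
  unfold Fstar; congr 1; funext k; congr 1; ring

/-- The two-term relation between the differences of solutions attached to `(0, e)` and to
`(f, g)`, under extra convergence and genericity conditions. -/
lemma difference_relation_of_re {a b c d e f g : ℂ} (h : e + f + g = a + b + c + d + 1)
    (hG : Generic ![a, b, c, d, e, f, g])
    (hre : 1 ≤ (e - a - b).re) (hre' : 1 ≤ (e - c - d).re)
    (hab : NotInt (e - a - b)) (hcd : NotInt (e - c - d)) (hac : NotInt (e - a - c))
    (had : NotInt (e - a - d)) (hbc : NotInt (e - b - c)) (hbd : NotInt (e - b - d)) :
    Fstar a b c d e f g -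
        Fstar (1 + a - e) (1 + b - e) (1 + c - e) (1 + d - e) (2 - e) (1 + f - e) (1 + g - e) =
      Sn e / Sn (g - f) * (Gamma a * Gamma b * Gamma c * Gamma d *
        (Gamma (1 + a - e) * Gamma (1 + b - e) * Gamma (1 + c - e) * Gamma (1 + d - e))) *
        ((Gamma (f - a))⁻¹ * (Gamma (f - b))⁻¹ * (Gamma (f - c))⁻¹ * (Gamma (f - d))⁻¹ *
        ((Gamma (g - a))⁻¹ * (Gamma (g - b))⁻¹ * (Gamma (g - c))⁻¹ * (Gamma (g - d))⁻¹)) *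
        (Fstar (f - a) (f - b) (f - c) (f - d) f (1 + f - e) (1 + f - g) -
          Fstar (g - a) (g - b) (g - c) (g - d) g (1 + g - e) (1 + g - f)) := by
  have ha : NotInt a := hG.1 0
  have hb : NotInt b := hG.1 1
  have hc : NotInt c := hG.1 2
  have hd : NotInt d := hG.1 3
  have hf : NotInt f := hG.1 5
  have hg : NotInt g := hG.1 6
  have ea : NotInt (e - a) := hG.2 4 0 (by decide)
  have eb : NotInt (e - b) := hG.2 4 1 (by decide)
  have ec : NotInt (e - c) := hG.2 4 2 (by decide)
  have ed : NotInt (e - d) := hG.2 4 3 (by decide)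
  have fa : NotInt (f - a) := hG.2 5 0 (by decide)
  have fb : NotInt (f - b) := hG.2 5 1 (by decide)
  have fc : NotInt (f - c) := hG.2 5 2 (by decide)
  have fd : NotInt (f - d) := hG.2 5 3 (by decide)
  have ga : NotInt (g - a) := hG.2 6 0 (by decide)
  have gb : NotInt (g - b) := hG.2 6 1 (by decide)
  have gc : NotInt (g - c) := hG.2 6 2 (by decide)
  have gd : NotInt (g - d) := hG.2 6 3 (by decide)
  have ef : NotInt (e - f) := hG.2 4 5 (by decide)
  have eg : NotInt (e - g) := hG.2 4 6 (by decide)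
  have gf : NotInt (g - f) := hG.2 6 5 (by decide)
  have dc : NotInt (d - c) := hG.2 3 2 (by decide)
  have h₁ := sears_transformation h hre ha hb hc hd hf hg ea eb ec ed ef eg gd fd gc fc dc
    (hbc.of_eq_sub 1 (by push_cast; linear_combination h))
    (hac.of_eq_sub 1 (by push_cast; linear_combination h))
    (hbd.of_eq_sub 1 (by push_cast; linear_combination h))
    (had.of_eq_sub 1 (by push_cast; linear_combination h)) hab
  have h₂ := sears_transformation (a := c) (b := 1 + c - e) (c := f - d) (d := g - d)
    (e := 1 + c - d) (f := f + g - d - a) (g := f + g - d - b) (by linear_combination h)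
    (by rwa [show 1 + c - d - c - (1 + c - e) = e - c - d by ring]) hc
    (ec.of_eq_sub 1 (by push_cast; ring)) fd gd
    (hbc.of_eq_sub 1 (by push_cast; linear_combination h))
    (hac.of_eq_sub 1 (by push_cast; linear_combination h))
    (hd.of_eq_sub 1 (by push_cast; ring))
    (ed.of_eq_add 0 (by push_cast; ring))
    (fc.of_eq_sub 1 (by push_cast; ring))
    (gc.of_eq_sub 1 (by push_cast; ring))
    (hbd.of_eq_add 0 (by push_cast; linear_combination -h))
    (had.of_eq_add 0 (by push_cast; linear_combination -h))
    (fb.of_eq_add 0 (by push_cast; ring))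
    (fa.of_eq_add 0 (by push_cast; ring))
    (gb.of_eq_add 0 (by push_cast; ring))
    (ga.of_eq_add 0 (by push_cast; ring))
    (gf.of_eq_add 0 (by push_cast; ring))
    (ef.of_eq_sub 1 (by push_cast; linear_combination h))
    (hf.of_eq_add 0 (by push_cast; linear_combination h))
    (eg.of_eq_sub 1 (by push_cast; linear_combination h))
    (hg.of_eq_add 0 (by push_cast; linear_combination h))
    (hcd.of_eq_add 0 (by push_cast; ring))
  rw [show 1 + c - (1 + c - d) = d by ring, show 1 + (1 + c - e) - (1 + c - d) = 1 + d - e by ring,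
    show 1 + (f - d) - (1 + c - d) = f - c by ring, show 1 + (g - d) - (1 + c - d) = g - c by ring,
    show 2 - (1 + c - d) = 1 + d - c by ring,
    show 1 + (f + g - d - a) - (1 + c - d) = f + g - c - a by ring,
    show 1 + (f + g - d - b) - (1 + c - d) = f + g - c - b by ring,
    show g - d - (f - d) = g - f by ring, show f + g - d - b - (g - d) = f - b by ring,
    show f + g - d - a - (g - d) = f - a by ring, show f + g - d - b - (f - d) = g - b by ring,
    show f + g - d - a - (f - d) = g - a by ring,
    show f + g - d - a + (f + g - d - b) - (g - d) - c = 1 + f - e by linear_combination h,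
    show f + g - d - a + (f + g - d - b) - (g - d) - (1 + c - e) = f by linear_combination h,
    show f + g - d - a + (f + g - d - b) - (f - d) - c = 1 + g - e by linear_combination h,
    show f + g - d - a + (f + g - d - b) - (f - d) - (1 + c - e) = g by linear_combination h,
    show 1 + (f - d) - (g - d) = 1 + f - g by ring, show 1 + (g - d) - (f - d) = 1 + g - f by ring,
    Sn_one_add_sub, Fstar_swap_upper c, Fstar_swap_upper d, Fstar_reverse_upper (f - d),
    Fstar_reverse_upper (g - d), Fstar_rotate_lower _ _ _ _ (1 + f - g),
    Fstar_rotate_lower _ _ _ _ (1 + g - f)] at h₂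
  rw [h₁, h₂]
  generalize Fstar _ _ _ _ _ _ _ - Fstar _ _ _ _ _ _ _ = D
  rw [← div_mul_div_cancel₀ (a := Sn e) (c := Sn (g - f)) dc.Sn_ne_zero]
  simp only [mul_inv]
  ring

lemma generic_shift_ef (a b c d e f g z : ℂ) :
    (fun i => (![a, b, c, d, e, f, g] : Fin 7 → ℂ) i +
      z * (![0, 0, 0, 0, 1, -1, 0] : Fin 7 → ℂ) i) = ![a, b, c, d, e + z, f - z, g] := by
  funext i; fin_cases i <;> simp [sub_eq_add_neg]

/-- The two-term relation between the differences of solutions attached to `(0, e)` and to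
`(f, g)`. -/
theorem difference_relation {a b c d e f g : ℂ} (h : e + f + g = a + b + c + d + 1)
    (hG : Generic ![a, b, c, d, e, f, g]) :
    Fstar a b c d e f g -
        Fstar (1 + a - e) (1 + b - e) (1 + c - e) (1 + d - e) (2 - e) (1 + f - e) (1 + g - e) =
      Sn e / Sn (g - f) * (Gamma a * Gamma b * Gamma c * Gamma d *
        (Gamma (1 + a - e) * Gamma (1 + b - e) * Gamma (1 + c - e) * Gamma (1 + d - e))) *
        ((Gamma (f - a))⁻¹ * (Gamma (f - b))⁻¹ * (Gamma (f - c))⁻¹ * (Gamma (f - d))⁻¹ *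
        ((Gamma (g - a))⁻¹ * (Gamma (g - b))⁻¹ * (Gamma (g - c))⁻¹ * (Gamma (g - d))⁻¹)) *
        (Fstar (f - a) (f - b) (f - c) (f - d) f (1 + f - e) (1 + f - g) -
          Fstar (g - a) (g - b) (g - c) (g - d) g (1 + g - e) (1 + g - f)) := by
  set Φ : ℂ → ℂ := fun z =>
    (Fstar a b c d (e + z) (f - z) g -
        Fstar (1 + a - (e + z)) (1 + b - (e + z)) (1 + c - (e + z)) (1 + d - (e + z)) (2 - (e + z))
          (1 + (f - z) - (e + z)) (1 + g - (e + z))) -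
      Sn (e + z) / Sn (g - (f - z)) * (Gamma a * Gamma b * Gamma c * Gamma d *
        (Gamma (1 + a - (e + z)) * Gamma (1 + b - (e + z)) * Gamma (1 + c - (e + z)) *
          Gamma (1 + d - (e + z)))) *
        ((Gamma (f - z - a))⁻¹ * (Gamma (f - z - b))⁻¹ * (Gamma (f - z - c))⁻¹ *
          (Gamma (f - z - d))⁻¹ *
        ((Gamma (g - a))⁻¹ * (Gamma (g - b))⁻¹ * (Gamma (g - c))⁻¹ * (Gamma (g - d))⁻¹)) *
        (Fstar (f - z - a) (f - z - b) (f - z - c) (f - z - d) (f - z) (1 + (f - z) - (e + z))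
            (1 + (f - z) - g) -
          Fstar (g - a) (g - b) (g - c) (g - d) g (1 + g - (e + z)) (1 + g - (f - z))) with hΦ
  set M : ℝ := |(e - a - b).re| + |(e - c - d).re| + 1 with hM
  have hmain : Φ 0 = 0 := by
    refine eq_zero_of_generic_line (v := ![a, b, c, d, e, f, g]) (w := ![0, 0, 0, 0, 1, -1, 0]) hG
      (W := {z | M < z.re})
      (E := ⋃ p ∈ ({e - a - b, e - c - d, e - a - c, e - a - d, e - b - c, e - b - d} : Finset ℂ),
        {z : ℂ | NotInt (p + z * 1)}ᶜ)
      (fun z hz => ?_) (isOpen_lt continuous_const continuous_re) ⟨(M + 1 : ℝ), by simp⟩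
      (Set.Countable.biUnion (Finset.countable_toSet _)
        fun p _ => countable_compl_notInt (.inl one_ne_zero)) fun z hzM hzE hz => ?_
    · rw [generic_shift_ef] at hz
      have g1 : ∀ {y : ℂ}, NotInt (e + z - y) → Gamma (1 + y - (e + z)) ≠ 0 := fun hy =>
        (hy.of_eq_sub 1 (by push_cast; ring)).Gamma_ne_zero
      have g2 : ∀ {y : ℂ}, NotInt (e + z - y) →
          DifferentiableAt ℂ (fun z => Gamma (1 + y - (e + z))) z := fun hy =>
        differentiableAt_Gamma_comp (by fun_prop) (g1 hy)
      have g3 : ∀ y : ℂ, DifferentiableAt ℂ (fun z => (Gamma (f - z - y))⁻¹) z := fun y =>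
        differentiableAt_inv_Gamma_comp (by fun_prop)
      have a0 : NotInt (e + z - a) := hz.2 4 0 (by decide)
      have a1 : NotInt (e + z - b) := hz.2 4 1 (by decide)
      have a2 : NotInt (e + z - c) := hz.2 4 2 (by decide)
      have a3 : NotInt (e + z - d) := hz.2 4 3 (by decide)
      have F0 := differentiableAt_Fstar (a := fun _ => a) (b := fun _ => b) (c := fun _ => c)
        (d := fun _ => d) (e := fun z => e + z) (f := fun z => f - z) (g := fun _ => g) (z₀ := z)
        (by fun_prop) (by fun_prop) (by fun_prop) (by fun_prop) (by fun_prop) (by fun_prop)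
        (by fun_prop) (fun z => by linear_combination h) (hz.1 0).Gamma_ne_zero
        (hz.1 1).Gamma_ne_zero (hz.1 2).Gamma_ne_zero (hz.1 3).Gamma_ne_zero
      have F1 := differentiableAt_Fstar (a := fun z => 1 + a - (e + z))
        (b := fun z => 1 + b - (e + z)) (c := fun z => 1 + c - (e + z))
        (d := fun z => 1 + d - (e + z)) (e := fun z => 2 - (e + z))
        (f := fun z => 1 + (f - z) - (e + z)) (g := fun z => 1 + g - (e + z)) (z₀ := z)
        (by fun_prop) (by fun_prop) (by fun_prop) (by fun_prop) (by fun_prop) (by fun_prop)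
        (by fun_prop) (fun z => by linear_combination h) (g1 a0) (g1 a1) (g1 a2) (g1 a3)
      have F2 := differentiableAt_Fstar (a := fun z => f - z - a)
        (b := fun z => f - z - b) (c := fun z => f - z - c)
        (d := fun z => f - z - d) (e := fun z => f - z)
        (f := fun z => 1 + (f - z) - (e + z)) (g := fun z => 1 + (f - z) - g) (z₀ := z)
        (by fun_prop) (by fun_prop) (by fun_prop) (by fun_prop) (by fun_prop) (by fun_prop)
        (by fun_prop) (fun z => by linear_combination -h) (hz.2 5 0 (by decide)).Gamma_ne_zero
        (hz.2 5 1 (by decide)).Gamma_ne_zero (hz.2 5 2 (by decide)).Gamma_ne_zero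
        (hz.2 5 3 (by decide)).Gamma_ne_zero
      have F3 := differentiableAt_Fstar (a := fun _ => g - a)
        (b := fun _ => g - b) (c := fun _ => g - c)
        (d := fun _ => g - d) (e := fun _ => g)
        (f := fun z => 1 + g - (e + z)) (g := fun z => 1 + g - (f - z)) (z₀ := z)
        (by fun_prop) (by fun_prop) (by fun_prop) (by fun_prop) (by fun_prop) (by fun_prop)
        (by fun_prop) (fun z => by linear_combination -h) (hz.2 6 0 (by decide)).Gamma_ne_zero
        (hz.2 6 1 (by decide)).Gamma_ne_zero (hz.2 6 2 (by decide)).Gamma_ne_zero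
        (hz.2 6 3 (by decide)).Gamma_ne_zero
      have S1 : DifferentiableAt ℂ (fun z => Sn (e + z)) z :=
        (differentiable_Sn.comp (by fun_prop : Differentiable ℂ fun z : ℂ => e + z)) z
      have S2 : DifferentiableAt ℂ (fun z => Sn (g - (f - z))) z :=
        (differentiable_Sn.comp (by fun_prop : Differentiable ℂ fun z : ℂ => g - (f - z))) z
      exact (F0.sub F1).sub ((((S1.div S2 (hz.2 6 5 (by decide)).Sn_ne_zero).mul
        ((((g2 a0).mul (g2 a1)).mul (g2 a2)).mul (g2 a3) |>.const_mul _)).mul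
        (((((g3 a).mul (g3 b)).mul (g3 c)).mul (g3 d)).mul_const _)).mul (F2.sub F3))
    · rw [generic_shift_ef] at hz
      have hgen : ∀ p ∈ ({e - a - b, e - c - d, e - a - c, e - a - d, e - b - c, e - b - d} :
          Finset ℂ), NotInt (p + z * 1) := by
        intro p hp
        by_contra hn
        exact hzE (Set.mem_biUnion hp hn)
      have hzM' : M < z.re := hzM
      refine sub_eq_zero.mpr (difference_relation_of_re (by linear_combination h) hz ?_ ?_
        ((hgen (e - a - b) (by simp)).of_eq_add 0 (by push_cast; ring))
        ((hgen (e - c - d) (by simp)).of_eq_add 0 (by push_cast; ring))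
        ((hgen (e - a - c) (by simp)).of_eq_add 0 (by push_cast; ring))
        ((hgen (e - a - d) (by simp)).of_eq_add 0 (by push_cast; ring))
        ((hgen (e - b - c) (by simp)).of_eq_add 0 (by push_cast; ring))
        ((hgen (e - b - d) (by simp)).of_eq_add 0 (by push_cast; ring)))
      · rw [show e + z - a - b = (e - a - b) + z by ring, add_re]
        linarith [neg_abs_le (e - a - b).re, abs_nonneg (e - c - d).re]
      · rw [show e + z - c - d = (e - c - d) + z by ring, add_re]
        linarith [neg_abs_le (e - c - d).re, abs_nonneg (e - a - b).re]
  simp only [hΦ, add_zero, sub_zero] at hmain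
  exact sub_eq_zero.mp hmain

lemma rpow_kernel_bound {x y z : ℝ} (hx : 1 ≤ x) (hy : 1 ≤ y) (hz : 1 ≤ z) (hzxy : z ≤ x * y) :
    x ^ (-9 / 20 : ℝ) * y⁻¹ ≤
      (x ^ (-21 / 20 : ℝ) + y ^ (-21 / 20 : ℝ)) * z ^ (-1 / 5 : ℝ) := by
  have hx0 : 0 < x := by linarith
  have hy0 : 0 < y := by linarith
  have hz0 : 0 < z := by linarith
  have key : x ^ (-1 / 4 : ℝ) * y ^ (-4 / 5 : ℝ) ≤ x ^ (-21 / 20 : ℝ) + y ^ (-21 / 20 : ℝ) := by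
    rcases le_total x y with hxy | hxy
    · calc x ^ (-1 / 4 : ℝ) * y ^ (-4 / 5 : ℝ) ≤ x ^ (-1 / 4 : ℝ) * x ^ (-4 / 5 : ℝ) := by
            gcongr 1
            exact Real.rpow_le_rpow_of_nonpos hx0 hxy (by norm_num)
        _ = x ^ (-21 / 20 : ℝ) := by rw [← Real.rpow_add hx0]; norm_num
        _ ≤ _ := le_add_of_nonneg_right (by positivity)
    · calc x ^ (-1 / 4 : ℝ) * y ^ (-4 / 5 : ℝ) ≤ y ^ (-1 / 4 : ℝ) * y ^ (-4 / 5 : ℝ) := by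
            gcongr 1
            exact Real.rpow_le_rpow_of_nonpos hy0 hxy (by norm_num)
        _ = y ^ (-21 / 20 : ℝ) := by rw [← Real.rpow_add hy0]; norm_num
        _ ≤ _ := le_add_of_nonneg_left (by positivity)
  have h1 : z ^ (1 / 5 : ℝ) ≤ x ^ (1 / 5 : ℝ) * y ^ (1 / 5 : ℝ) := by
    rw [← Real.mul_rpow hx0.le hy0.le]; gcongr
  calc x ^ (-9 / 20 : ℝ) * y⁻¹
      = x ^ (-9 / 20 : ℝ) * y ^ (-1 : ℝ) * (z ^ (1 / 5 : ℝ) * z ^ (-1 / 5 : ℝ)) := by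
        rw [← Real.rpow_add hz0, Real.rpow_neg_one]; norm_num
    _ ≤ x ^ (-9 / 20 : ℝ) * y ^ (-1 : ℝ) *
          (x ^ (1 / 5 : ℝ) * y ^ (1 / 5 : ℝ) * z ^ (-1 / 5 : ℝ)) := by gcongr
    _ = (x ^ (-9 / 20 : ℝ) * x ^ (1 / 5 : ℝ)) * (y ^ (-1 : ℝ) * y ^ (1 / 5 : ℝ)) *
          z ^ (-1 / 5 : ℝ) := by ring
    _ = x ^ (-1 / 4 : ℝ) * y ^ (-4 / 5 : ℝ) * z ^ (-1 / 5 : ℝ) := by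
        rw [← Real.rpow_add hx0, ← Real.rpow_add hy0]; norm_num
    _ ≤ _ := by gcongr

lemma summable_abs_int_rpow : Summable fun m : ℤ => ((|m| : ℝ) + 1) ^ (-21 / 20 : ℝ) := by
  have h := summable_rpow_succ (p := -21 / 20) (by norm_num)
  refine Summable.of_nat_of_neg ?_ ?_ <;> simpa using h

/-- Absolute row sums of `A` are finite and decay like `i ^ (-1/5)`. -/
def RowSumBound (A : ℕ → ℕ → ℂ) : Prop :=
  ∃ G : ℝ, 0 ≤ G ∧ ∀ i, Summable (fun j => ‖A i j‖) ∧
    ∑' j, ‖A i j‖ ≤ G * ((i : ℝ) + 1) ^ (-1 / 5 : ℝ)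

lemma rowSumBound_of_kernel {A : ℕ → ℕ → ℂ} {C : ℝ} (hC : 0 ≤ C)
    (hA : ∀ i j : ℕ, ‖A i j‖ ≤
      C * (((j : ℝ) + 1) ^ (-9 / 20 : ℝ) * (|(i : ℝ) - j| + 1)⁻¹)) : RowSumBound A := by
  have s1 := summable_rpow_succ (p := -21 / 20) (by norm_num)
  have s2 := summable_abs_int_rpow
  set T : ℤ → ℝ := fun m => ((|m| : ℝ) + 1) ^ (-21 / 20 : ℝ) with hT
  have hT0 : ∀ m, 0 ≤ T m := fun m => by positivity
  have inj : ∀ i : ℕ, Function.Injective fun j : ℕ => (i : ℤ) - j := fun i j k h => by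
    simpa using h
  refine ⟨C * (∑' n : ℕ, ((n : ℝ) + 1) ^ (-21 / 20 : ℝ) + ∑' m, T m),
    mul_nonneg hC (add_nonneg (tsum_nonneg fun _ => by positivity) (tsum_nonneg hT0)),
    fun i => ?_⟩
  have s3 : Summable fun j : ℕ => T ((i : ℤ) - j) := s2.comp_injective (inj i)
  have hle : ∀ j : ℕ, ‖A i j‖ ≤ C * ((((j : ℝ) + 1) ^ (-21 / 20 : ℝ) + T ((i : ℤ) - j)) *
      ((i : ℝ) + 1) ^ (-1 / 5 : ℝ)) := fun j => by
    refine (hA i j).trans (mul_le_mul_of_nonneg_left ?_ hC)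
    have := rpow_kernel_bound (x := (j : ℝ) + 1) (y := |(i : ℝ) - j| + 1) (z := (i : ℝ) + 1)
      (by simp) (by simp) (by simp)
      (by nlinarith [le_abs_self ((i : ℝ) - j),
        mul_nonneg j.cast_nonneg (abs_nonneg ((i : ℝ) - j))])
    simpa [hT] using this
  have s4 : Summable fun j : ℕ => C * ((((j : ℝ) + 1) ^ (-21 / 20 : ℝ) + T ((i : ℤ) - j)) *
      ((i : ℝ) + 1) ^ (-1 / 5 : ℝ)) := ((s1.add s3).mul_right _).mul_left _
  have s5 : Summable fun j => ‖A i j‖ := .of_nonneg_of_le (fun _ => norm_nonneg _) hle s4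
  refine ⟨s5, (s5.tsum_le_tsum hle s4).trans ?_⟩
  rw [tsum_mul_left, tsum_mul_right, s1.tsum_add s3, mul_assoc]
  gcongr
  exact tsum_comp_le_tsum_of_inj s2 hT0 (inj i)

lemma NotInt.norm_inv_add_int_le {u : ℂ} (hu : NotInt u) :
    ∃ C : ℝ, 0 ≤ C ∧ ∀ m : ℤ, ‖(u + m)⁻¹‖ ≤ C * (|(m : ℝ)| + 1)⁻¹ := by
  have hne : ∀ m : ℤ, u + m ≠ 0 := fun m h => hu (-m) (by push_cast; linear_combination h)
  obtain ⟨δ, hδ, hball⟩ := Metric.isOpen_iff.mp Complex.isOpen_compl_range_intCast (-u)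
    (by rintro ⟨m, hm⟩; exact hne m (by rw [hm]; ring))
  have hlow : ∀ m : ℤ, δ ≤ ‖u + m‖ := fun m => by
    by_contra! hlt
    exact hball (by rwa [Metric.mem_ball, dist_eq_norm, sub_neg_eq_add, add_comm]) ⟨m, rfl⟩
  refine ⟨1 + (‖u‖ + 1) / δ, by positivity, fun m => ?_⟩
  have hm : 0 < ‖u + m‖ := hδ.trans_le (hlow m)
  rw [norm_inv, ← div_eq_mul_inv, inv_le_comm₀ hm (by positivity), inv_div,
    div_le_iff₀ (by positivity)]
  have h1 : |(m : ℝ)| ≤ ‖u + m‖ + ‖u‖ := by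
    rw [← Complex.norm_intCast]
    simpa using norm_sub_le (u + m) u
  have h2 : ‖u‖ + 1 ≤ ‖u + m‖ * ((‖u‖ + 1) / δ) := by
    rw [mul_div_assoc', le_div_iff₀ hδ, mul_comm]
    exact mul_le_mul_of_nonneg_right (hlow m) (by positivity)
  linarith

lemma summable_norm_mul_three {f g h : ℕ → ℂ} (hf : Summable fun j => ‖f j‖)
    (hg : Summable fun j => ‖g j‖) (hh : Summable fun j => ‖h j‖) :
    Summable fun q : ℕ × ℕ × ℕ => ‖f q.1 * (g q.2.1 * h q.2.2)‖ :=
  hf.mul_norm (g := fun q : ℕ × ℕ => g q.1 * h q.2) (hg.mul_norm hh)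

lemma tsum_mul_three {R : Type*} [NormedRing R] [CompleteSpace R] {f g h : ℕ → R}
    (hf : Summable fun j => ‖f j‖) (hg : Summable fun j => ‖g j‖)
    (hh : Summable fun j => ‖h j‖) :
    ∑' q : ℕ × ℕ × ℕ, f q.1 * (g q.2.1 * h q.2.2) =
      (∑' j, f j) * ((∑' j, g j) * ∑' j, h j) := by
  rw [tsum_mul_tsum_of_summable_norm hg hh,
    tsum_mul_tsum_of_summable_norm hf (g := fun q : ℕ × ℕ => g q.1 * h q.2) (hg.mul_norm hh)]

lemma tsum_norm_mul_three {f g h : ℕ → ℂ} (hf : Summable fun j => ‖f j‖)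
    (hg : Summable fun j => ‖g j‖) (hh : Summable fun j => ‖h j‖) :
    ∑' q : ℕ × ℕ × ℕ, ‖f q.1 * (g q.2.1 * h q.2.2)‖ =
      (∑' j, ‖f j‖) * ((∑' j, ‖g j‖) * ∑' j, ‖h j‖) := by
  rw [← tsum_mul_three hf.norm hg.norm hh.norm]
  simp only [norm_mul]

lemma hasSum_four {r : ℕ → ℂ} {A B D : ℕ → ℕ → ℂ} {C : ℝ}
    (hr : ∀ i : ℕ, ‖r i‖ ≤ C * ((i : ℝ) + 1) ^ (-9 / 20 : ℝ))
    (hA : RowSumBound A) (hB : RowSumBound B) (hD : RowSumBound D) :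
    HasSum (fun q : ℕ × ℕ × ℕ × ℕ =>
        r q.1 * (A q.1 q.2.1 * (B q.1 q.2.2.1 * D q.1 q.2.2.2)))
      (∑' i, r i * ((∑' j, A i j) * ((∑' j, B i j) * ∑' j, D i j))) := by
  obtain ⟨G₁, hG₁, hA⟩ := hA
  obtain ⟨G₂, hG₂, hB⟩ := hB
  obtain ⟨G₃, hG₃, hD⟩ := hD
  have hs : Summable fun q : ℕ × ℕ × ℕ × ℕ =>
      ‖r q.1 * (A q.1 q.2.1 * (B q.1 q.2.2.1 * D q.1 q.2.2.2))‖ := by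
    refine (summable_prod_of_nonneg fun _ => norm_nonneg _).mpr ⟨fun i => ?_, ?_⟩
    · simpa only [norm_mul] using
        (summable_norm_mul_three (hA i).1 (hB i).1 (hD i).1).mul_left ‖r i‖
    · have s0 := (summable_rpow_succ (p := -21 / 20) (by norm_num)).mul_left
        (C * (G₁ * (G₂ * G₃)))
      refine .of_nonneg_of_le (fun i => tsum_nonneg fun _ => norm_nonneg _) (fun i => ?_) s0
      have hi : (0 : ℝ) < (i : ℝ) + 1 := by positivity
      have hC0 : 0 ≤ C * ((i : ℝ) + 1) ^ (-9 / 20 : ℝ) := (norm_nonneg _).trans (hr i)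
      have n0 : ∀ {u : ℕ → ℂ}, 0 ≤ ∑' j, ‖u j‖ := tsum_nonneg fun _ => norm_nonneg _
      simp only [norm_mul (r i)]
      rw [tsum_mul_left, tsum_norm_mul_three (hA i).1 (hB i).1 (hD i).1]
      calc _ ≤ (C * ((i : ℝ) + 1) ^ (-9 / 20 : ℝ)) * ((G₁ * ((i : ℝ) + 1) ^ (-1 / 5 : ℝ)) *
            ((G₂ * ((i : ℝ) + 1) ^ (-1 / 5 : ℝ)) * (G₃ * ((i : ℝ) + 1) ^ (-1 / 5 : ℝ)))) :=
            mul_le_mul (hr i) (mul_le_mul (hA i).2 (mul_le_mul (hB i).2 (hD i).2 n0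
              (by positivity)) (mul_nonneg n0 n0) (by positivity))
              (mul_nonneg n0 (mul_nonneg n0 n0)) hC0
        _ = C * (G₁ * (G₂ * G₃)) * (((i : ℝ) + 1) ^ (-9 / 20 : ℝ) * (((i : ℝ) + 1) ^ (-1 / 5 : ℝ) *
            (((i : ℝ) + 1) ^ (-1 / 5 : ℝ) * ((i : ℝ) + 1) ^ (-1 / 5 : ℝ)))) := by ring
        _ = _ := by
            rw [← Real.rpow_add hi, ← Real.rpow_add hi, ← Real.rpow_add hi]; norm_num
  refine hs.of_norm.hasSum_iff.mpr ?_
  rw [hs.of_norm.tsum_prod]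
  congr 1; funext i
  rw [← tsum_mul_three (hA i).1 (hB i).1 (hD i).1, ← tsum_mul_left]

/-- Coefficients of the partial fraction expansion of `Γ(u) / Γ(u + β)`. -/
def betaCoeff (β : ℂ) (n : ℕ) : ℂ := Gamma (n + (1 - β)) / n.factorial

lemma norm_betaCoeff_le {β : ℂ} (hβ : 9 / 20 ≤ β.re) :
    ∃ C : ℝ, 0 ≤ C ∧ ∀ n : ℕ, ‖betaCoeff β n‖ ≤ C * ((n : ℝ) + 1) ^ (-9 / 20 : ℝ) := by
  obtain ⟨C, hC0, hC⟩ := Gamma_ratio_bound (1 - β) 1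
  refine ⟨C, hC0.le, fun n => ?_⟩
  rw [betaCoeff, ← Gamma_nat_eq_factorial]
  refine (hC n).trans ?_
  gcongr
  · simp
  · simp; linarith

lemma tsum_betaCoeff {β u : ℂ} (hβ : NotInt β) (hre : 0 < β.re) (hu : NotInt u)
    (huβ : NotInt (u + β)) :
    ∑' n, betaCoeff β n * (u + n)⁻¹ = Real.pi / Sn β * (Gamma u / Gamma (u + β)) := by
  have h := tsum_gaussTerm (a := 1 - β) (b := u) (c := u + 1)
    (hβ.of_eq_sub 1 (by push_cast; ring)).Gamma_ne_zero hu.Gamma_ne_zero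
    (by rw [show u + 1 - (1 - β) = u + β by ring]; exact huβ.Gamma_ne_zero)
    (by simp) (by rwa [show u + 1 - (1 - β) - u = β by ring])
  rw [show u + 1 - (1 - β) = u + β by ring, show u + β - u = β by ring,
    show u + 1 - u = 1 by ring, Gamma_one] at h
  have e : ∀ n, betaCoeff β n * (u + n)⁻¹ = gaussTerm (1 - β) u (u + 1) n := fun n => by
    have h1 : u + n ≠ 0 := add_nat_ne_zero hu.Gamma_ne_zero n
    have h2 := Gamma_add_nat_ne_zero hu.Gamma_ne_zero n
    rw [betaCoeff, gaussTerm, show (n : ℂ) + (u + 1) = (u + n) + 1 by ring, Gamma_add_one _ h1,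
      add_comm (n : ℂ) u]
    field_simp
  rw [tsum_congr e, h]
  have h3 := Complex.Gamma_mul_Gamma_one_sub β
  rw [← Sn] at h3
  rw [← h3]; ring

lemma rowSumBound_betaCoeff {β u : ℂ} (hβ : 9 / 20 ≤ β.re) (hu : NotInt u) {m : ℕ → ℕ → ℤ}
    (hm : ∀ i j : ℕ, |(i : ℤ) - j| ≤ |m i j|) :
    RowSumBound fun i j => betaCoeff β j * (u + m i j)⁻¹ := by
  obtain ⟨C₁, hC₁, h₁⟩ := norm_betaCoeff_le hβ
  obtain ⟨C₂, hC₂, h₂⟩ := hu.norm_inv_add_int_le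
  refine rowSumBound_of_kernel (mul_nonneg hC₁ hC₂) fun i j => ?_
  have h3 : |(i : ℝ) - j| ≤ |(m i j : ℝ)| := by exact_mod_cast hm i j
  rw [norm_mul]
  calc _ ≤ C₁ * ((j : ℝ) + 1) ^ (-9 / 20 : ℝ) * (C₂ * (|(m i j : ℝ)| + 1)⁻¹) := by
        gcongr
        exacts [h₁ j, h₂ _]
    _ ≤ C₁ * ((j : ℝ) + 1) ^ (-9 / 20 : ℝ) * (C₂ * (|(i : ℝ) - j| + 1)⁻¹) := by gcongr
    _ = _ := by ring

lemma Sn_sub_nat (x : ℂ) (n : ℕ) : Sn (x - n) = (-1) ^ n * Sn x := by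
  rw [Sn, Sn, ← Complex.sin_antiperiodic.sub_nat_mul_eq n]; congr 1; ring

lemma Gamma_ratio_reflect {w β : ℂ} (hw : NotInt w) (hwβ : NotInt (w + β)) (n : ℕ) :
    Gamma (w - n) / Gamma (w - n + β) =
      Sn (w + β) / Sn w * (Gamma (n + (1 - w - β)) / Gamma (n + (1 - w))) := by
  have h1 : NotInt (w - n) := hw.of_eq_add (-n) (by push_cast; ring)
  have h2 : NotInt (n + (1 - w - β)) := hwβ.of_eq_sub (n + 1) (by push_cast; ring)
  rw [div_eq_mul_inv _ (Gamma (w - n + β)), div_eq_mul_inv _ (Gamma (n + (1 - w))),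
    h1.inv_Gamma (y := n + (1 - w)) (by ring), h2.inv_Gamma (y := w - n + β) (by ring),
    show (n : ℂ) + (1 - w - β) = 1 + n - (w + β) by ring,
    show 1 + (n : ℂ) - (w + β) = 1 + n - (w + β) by ring, Sn_sub_nat, Sn_one_add_sub,
    Sn_sub_nat]
  have := hw.Sn_ne_zero
  field_simp

lemma tsum_betaCoeff_sub_nat {w β : ℂ} (h : 0 < β.re) (n : NotInt β) (hw : NotInt w)
    (hz : NotInt (w + β)) (i : ℕ) :
    ∑' j : ℕ, betaCoeff β j * (w + ((j - i : ℤ) : ℂ))⁻¹ = Real.pi / Sn β *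
      (Sn (w + β) / Sn w * (Gamma (i + (1 - w - β)) / Gamma (i + (1 - w)))) := by
  rw [← Gamma_ratio_reflect hw hz, ← tsum_betaCoeff n h
    (hw.of_eq_add (-i) (by push_cast; ring)) (hz.of_eq_add (-i) (by push_cast; ring))]
  refine tsum_congr fun j => ?_
  push_cast; ring

lemma tsum_betaCoeff_add_nat {w β : ℂ} (h : 0 < β.re) (n : NotInt β) (hw : NotInt w)
    (hz : NotInt (w + β)) (i : ℕ) :
    ∑' j : ℕ, betaCoeff β j * (w + ((j + i : ℤ) : ℂ))⁻¹ =
      Real.pi / Sn β * (Gamma (i + w) / Gamma (i + (w + β))) := by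
  rw [show (i : ℂ) + (w + β) = i + w + β by ring, ← tsum_betaCoeff n h
    (hw.of_eq_add i (by push_cast; ring)) (hz.of_eq_add i (by push_cast; ring))]
  refine tsum_congr fun j => ?_
  push_cast; ring

lemma abs_sub_le_abs_add_nat (i j : ℕ) : |(i : ℤ) - j| ≤ |(j + i : ℤ)| := by
  rw [abs_of_nonneg (by positivity : (0 : ℤ) ≤ j + i), abs_le]; omega

lemma hasSum_reflected {u₁ u₂ u₃ v β₁ β₂ β₃ β₄ : ℂ} (h₁ : 9 / 20 ≤ β₁.re) (h₂ : 9 / 20 ≤ β₂.re)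
    (h₃ : 9 / 20 ≤ β₃.re) (h₄ : 9 / 20 ≤ β₄.re) (n₂ : NotInt β₂) (n₃ : NotInt β₃)
    (n₄ : NotInt β₄) (w₂ : NotInt (u₂ - u₁)) (w₃ : NotInt (u₃ - u₁)) (w₄ : NotInt (v + u₁))
    (z₂ : NotInt (u₂ - u₁ + β₂)) (z₃ : NotInt (u₃ - u₁ + β₃)) (z₄ : NotInt (v + u₁ + β₄)) :
    HasSum (fun q : ℕ × ℕ × ℕ × ℕ => betaCoeff β₁ q.1 *
        (betaCoeff β₂ q.2.1 * (u₂ - u₁ + ((q.2.1 - q.1 : ℤ) : ℂ))⁻¹ *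
          (betaCoeff β₃ q.2.2.1 * (u₃ - u₁ + ((q.2.2.1 - q.1 : ℤ) : ℂ))⁻¹ *
            (betaCoeff β₄ q.2.2.2 * (v + u₁ + ((q.2.2.2 + q.1 : ℤ) : ℂ))⁻¹))))
      (Real.pi / Sn β₂ * (Real.pi / Sn β₃) * (Real.pi / Sn β₄) *
        (Sn (u₂ - u₁ + β₂) / Sn (u₂ - u₁) * (Sn (u₃ - u₁ + β₃) / Sn (u₃ - u₁))) *
        Fstar (v + u₁) (1 - β₁) (1 - (u₂ - u₁) - β₂) (1 - (u₃ - u₁) - β₃)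
          (v + u₁ + β₄) (1 - (u₂ - u₁)) (1 - (u₃ - u₁))) := by
  obtain ⟨C, -, hC⟩ := norm_betaCoeff_le h₁
  convert hasSum_four hC
    (rowSumBound_betaCoeff (m := fun i j => j - i) h₂ w₂ fun i j => (abs_sub_comm _ _).le)
    (rowSumBound_betaCoeff (m := fun i j => j - i) h₃ w₃ fun i j => (abs_sub_comm _ _).le)
    (rowSumBound_betaCoeff (m := fun i j => j + i) h₄ w₄ abs_sub_le_abs_add_nat) using 1
  rw [← tsum_fstarTerm, ← tsum_mul_left]
  refine tsum_congr fun i => ?_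
  rw [tsum_betaCoeff_sub_nat (by linarith) n₂ w₂ z₂, tsum_betaCoeff_sub_nat (by linarith) n₃ w₃ z₃,
    tsum_betaCoeff_add_nat (by linarith) n₄ w₄ z₄, fstarTerm, betaCoeff]
  simp only [div_eq_mul_inv, mul_inv]
  ring

lemma hasSum_direct {u₁ u₂ u₃ v β₁ β₂ β₃ β₄ : ℂ} (h₁ : 9 / 20 ≤ β₁.re) (h₂ : 9 / 20 ≤ β₂.re)
    (h₃ : 9 / 20 ≤ β₃.re) (h₄ : 9 / 20 ≤ β₄.re) (n₁ : NotInt β₁) (n₂ : NotInt β₂)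
    (n₃ : NotInt β₃) (w₁ : NotInt (v + u₁)) (w₂ : NotInt (v + u₂)) (w₃ : NotInt (v + u₃))
    (z₁ : NotInt (v + u₁ + β₁)) (z₂ : NotInt (v + u₂ + β₂)) (z₃ : NotInt (v + u₃ + β₃)) :
    HasSum (fun q : ℕ × ℕ × ℕ × ℕ => betaCoeff β₄ q.1 *
        (betaCoeff β₁ q.2.1 * (v + u₁ + ((q.2.1 + q.1 : ℤ) : ℂ))⁻¹ *
          (betaCoeff β₂ q.2.2.1 * (v + u₂ + ((q.2.2.1 + q.1 : ℤ) : ℂ))⁻¹ *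
            (betaCoeff β₃ q.2.2.2 * (v + u₃ + ((q.2.2.2 + q.1 : ℤ) : ℂ))⁻¹))))
      (Real.pi / Sn β₁ * (Real.pi / Sn β₂) * (Real.pi / Sn β₃) *
        Fstar (1 - β₄) (v + u₁) (v + u₂) (v + u₃) (v + u₁ + β₁) (v + u₂ + β₂) (v + u₃ + β₃)) := by
  obtain ⟨C, -, hC⟩ := norm_betaCoeff_le h₄
  convert hasSum_four hC
    (rowSumBound_betaCoeff (m := fun i j => j + i) h₁ w₁ abs_sub_le_abs_add_nat)
    (rowSumBound_betaCoeff (m := fun i j => j + i) h₂ w₂ abs_sub_le_abs_add_nat)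
    (rowSumBound_betaCoeff (m := fun i j => j + i) h₃ w₃ abs_sub_le_abs_add_nat) using 1
  rw [← tsum_fstarTerm, ← tsum_mul_left]
  refine tsum_congr fun i => ?_
  rw [tsum_betaCoeff_add_nat (by linarith) n₁ w₁ z₁, tsum_betaCoeff_add_nat (by linarith) n₂ w₂ z₂,
    tsum_betaCoeff_add_nat (by linarith) n₃ w₃ z₃, fstarTerm, betaCoeff]
  simp only [div_eq_mul_inv, mul_inv]
  ring

lemma inv_mul_inv_mul_inv_eq {x y z : ℂ} (hx : x ≠ 0) (hy : y ≠ 0) (hz : z ≠ 0) (hxy : y - x ≠ 0)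
    (hxz : z - x ≠ 0) (hyz : z - y ≠ 0) :
    x⁻¹ * y⁻¹ * z⁻¹ = (y - x)⁻¹ * (z - x)⁻¹ * x⁻¹ + (x - y)⁻¹ * (z - y)⁻¹ * y⁻¹ +
      (x - z)⁻¹ * (y - z)⁻¹ * z⁻¹ := by
  have h₁ : x - y = -(y - x) := by ring
  have h₂ : x - z = -(z - x) := by ring
  have h₃ : y - z = -(z - y) := by ring
  rw [h₁, h₂, h₃]
  field_simp
  ring

/-- Sum of residues of a product of four quotients of Gamma functions. -/
lemma residue_relation {u₁ u₂ u₃ v β₁ β₂ β₃ β₄ : ℂ} (h₁ : 9 / 20 ≤ β₁.re) (h₂ : 9 / 20 ≤ β₂.re)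
    (h₃ : 9 / 20 ≤ β₃.re) (h₄ : 9 / 20 ≤ β₄.re) (n₁ : NotInt β₁) (n₂ : NotInt β₂)
    (n₃ : NotInt β₃) (n₄ : NotInt β₄) (w₁ : NotInt (v + u₁)) (w₂ : NotInt (v + u₂))
    (w₃ : NotInt (v + u₃)) (u₂₁ : NotInt (u₂ - u₁)) (u₃₁ : NotInt (u₃ - u₁))
    (u₃₂ : NotInt (u₃ - u₂)) (z₁ : NotInt (v + u₁ + β₁)) (z₂ : NotInt (v + u₂ + β₂))
    (z₃ : NotInt (v + u₃ + β₃)) (z₁₄ : NotInt (v + u₁ + β₄)) (z₂₄ : NotInt (v + u₂ + β₄))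
    (z₃₄ : NotInt (v + u₃ + β₄)) (z₂₁ : NotInt (u₂ - u₁ + β₂)) (z₃₁ : NotInt (u₃ - u₁ + β₃))
    (z₁₂ : NotInt (u₁ - u₂ + β₁)) (z₃₂ : NotInt (u₃ - u₂ + β₃)) (z₁₃ : NotInt (u₁ - u₃ + β₁))
    (z₂₃ : NotInt (u₂ - u₃ + β₂)) :
    Sn β₄ * Fstar (1 - β₄) (v + u₁) (v + u₂) (v + u₃) (v + u₁ + β₁) (v + u₂ + β₂) (v + u₃ + β₃) =
      Sn β₁ * (Sn (u₂ - u₁ + β₂) / Sn (u₂ - u₁) * (Sn (u₃ - u₁ + β₃) / Sn (u₃ - u₁))) *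
        Fstar (v + u₁) (1 - β₁) (1 - (u₂ - u₁) - β₂) (1 - (u₃ - u₁) - β₃)
          (v + u₁ + β₄) (1 - (u₂ - u₁)) (1 - (u₃ - u₁)) +
      Sn β₂ * (Sn (u₁ - u₂ + β₁) / Sn (u₁ - u₂) * (Sn (u₃ - u₂ + β₃) / Sn (u₃ - u₂))) *
        Fstar (v + u₂) (1 - β₂) (1 - (u₁ - u₂) - β₁) (1 - (u₃ - u₂) - β₃)
          (v + u₂ + β₄) (1 - (u₁ - u₂)) (1 - (u₃ - u₂)) +
      Sn β₃ * (Sn (u₁ - u₃ + β₁) / Sn (u₁ - u₃) * (Sn (u₂ - u₃ + β₂) / Sn (u₂ - u₃))) *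
        Fstar (v + u₃) (1 - β₃) (1 - (u₁ - u₃) - β₁) (1 - (u₂ - u₃) - β₂)
          (v + u₃ + β₄) (1 - (u₁ - u₃)) (1 - (u₂ - u₃)) := by
  have u₁₂ : NotInt (u₁ - u₂) := u₂₁.of_eq_sub 0 (by push_cast; ring)
  have u₁₃ : NotInt (u₁ - u₃) := u₃₁.of_eq_sub 0 (by push_cast; ring)
  have u₂₃ : NotInt (u₂ - u₃) := u₃₂.of_eq_sub 0 (by push_cast; ring)
  have H₁ := hasSum_reflected h₁ h₂ h₃ h₄ n₂ n₃ n₄ u₂₁ u₃₁ w₁ z₂₁ z₃₁ z₁₄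
  have H₂ := hasSum_reflected h₂ h₁ h₃ h₄ n₁ n₃ n₄ u₁₂ u₃₂ w₂ z₁₂ z₃₂ z₂₄
  have H₃ := hasSum_reflected h₃ h₁ h₂ h₄ n₁ n₂ n₄ u₁₃ u₂₃ w₃ z₁₃ z₂₃ z₃₄
  have H₄ := hasSum_direct h₁ h₂ h₃ h₄ n₁ n₂ n₃ w₁ w₂ w₃ z₁ z₂ z₃
  let e₂ : ℕ × ℕ × ℕ × ℕ ≃ ℕ × ℕ × ℕ × ℕ :=
    ⟨fun q => (q.2.1, q.1, q.2.2), fun q => (q.2.1, q.1, q.2.2), fun _ => rfl, fun _ => rfl⟩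
  let e₃ : ℕ × ℕ × ℕ × ℕ ≃ ℕ × ℕ × ℕ × ℕ :=
    ⟨fun q => (q.2.2.1, q.1, q.2.1, q.2.2.2), fun q => (q.2.1, q.2.2.1, q.1, q.2.2.2),
      fun _ => rfl, fun _ => rfl⟩
  let e₄ : ℕ × ℕ × ℕ × ℕ ≃ ℕ × ℕ × ℕ × ℕ :=
    ⟨fun q => (q.2.2.2, q.1, q.2.1, q.2.2.1), fun q => (q.2.1, q.2.2.1, q.2.2.2, q.1),
      fun _ => rfl, fun _ => rfl⟩
  have hsum := e₄.hasSum_iff.mpr H₄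
  have hsum' := (H₁.add (e₂.hasSum_iff.mpr H₂)).add (e₃.hasSum_iff.mpr H₃)
  have hne : ∀ {x : ℂ}, NotInt x → ∀ n : ℤ, x + n ≠ 0 := fun {x} hx n h =>
    hx (-n) (by push_cast; linear_combination h)
  have H := hsum.unique (hsum'.congr_fun ?_)
  · have hπ : (Real.pi : ℂ) ≠ 0 := by exact_mod_cast Real.pi_ne_zero
    have s₁ := n₁.Sn_ne_zero
    have s₂ := n₂.Sn_ne_zero
    have s₃ := n₃.Sn_ne_zero
    have s₄ := n₄.Sn_ne_zero
    clear_value e₂ e₃ e₄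
    clear H₁ H₂ H₃ H₄ hsum hsum' e₂ e₃ e₄
    revert H s₁ s₂ s₃ s₄
    generalize Sn (u₂ - u₁ + β₂) / Sn (u₂ - u₁) * (Sn (u₃ - u₁ + β₃) / Sn (u₃ - u₁)) = r₁
    generalize Sn (u₁ - u₂ + β₁) / Sn (u₁ - u₂) * (Sn (u₃ - u₂ + β₃) / Sn (u₃ - u₂)) = r₂
    generalize Sn (u₁ - u₃ + β₁) / Sn (u₁ - u₃) * (Sn (u₂ - u₃ + β₂) / Sn (u₂ - u₃)) = r₃
    generalize Fstar (1 - β₄) _ _ _ _ _ _ = F₀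
    generalize Fstar _ (1 - β₁) _ _ _ _ _ = F₁
    generalize Fstar _ (1 - β₂) _ _ _ _ _ = F₂
    generalize Fstar _ (1 - β₃) _ _ _ _ _ = F₃
    generalize Sn β₁ = t₁
    generalize Sn β₂ = t₂
    generalize Sn β₃ = t₃
    generalize Sn β₄ = t₄
    intro H s₁ s₂ s₃ s₄
    field_simp at H
    linear_combination H
  · rintro ⟨i, j, k, l⟩
    have key := inv_mul_inv_mul_inv_eq (hne w₁ (i + l)) (hne w₂ (j + l)) (hne w₃ (k + l))
      (fun h => hne u₂₁ (j - i) (by push_cast at h ⊢; linear_combination h))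
      (fun h => hne u₃₁ (k - i) (by push_cast at h ⊢; linear_combination h))
      (fun h => hne u₃₂ (k - j) (by push_cast at h ⊢; linear_combination h))
    simp only [Function.comp_apply, Equiv.coe_fn_mk, e₂, e₃, e₄]
    generalize betaCoeff β₁ i = b₁
    generalize betaCoeff β₂ j = b₂
    generalize betaCoeff β₃ k = b₃
    generalize betaCoeff β₄ l = b₄
    push_cast at key ⊢
    ring_nf at key ⊢
    linear_combination b₁ * b₂ * b₃ * b₄ * key

lemma Sn_neg (x : ℂ) : Sn (-x) = -Sn x := by
  rw [Sn, mul_neg, Complex.sin_neg, Sn]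

lemma Sn_one_sub (x : ℂ) : Sn (1 - x) = Sn x := by
  rw [Sn, mul_sub, mul_one, Complex.sin_pi_sub, Sn]

lemma three_two_relation_of_re {a b c d e f g : ℂ}
    (hG : Generic ![a, b, c, d, e, f, g]) (h₁ : 9 / 20 ≤ (1 - b).re) (h₂ : 9 / 20 ≤ (e - c).re)
    (h₃ : 9 / 20 ≤ (f - d).re) (h₄ : 9 / 20 ≤ (g - a).re) :
    Sn (g - a) * Fstar a (1 + a - e) (1 + a - f) (1 + a - g) (1 + a - b) (1 + a - c) (1 + a - d) =
      Sn b * Sn c * Sn d / (Sn e * Sn f) * Fstar a b c d e f g -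
      Sn (e - b) * Sn (e - c) * Sn (e - d) / (Sn e * Sn (e - f)) *
        Fstar (1 + a - e) (1 + b - e) (1 + c - e) (1 + d - e) (2 - e) (1 + f - e) (1 + g - e) -
      Sn (f - b) * Sn (f - c) * Sn (f - d) / (Sn f * Sn (f - e)) *
        Fstar (1 + a - f) (1 + b - f) (1 + c - f) (1 + d - f) (2 - f) (1 + e - f) (1 + g - f) := by
  have na : NotInt a := hG.1 0
  have nb : NotInt b := hG.1 1
  have nc : NotInt c := hG.1 2
  have nd : NotInt d := hG.1 3
  have ne : NotInt e := hG.1 4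
  have nf : NotInt f := hG.1 5
  have ng : NotInt g := hG.1 6
  have ab : NotInt (a - b) := hG.2 0 1 (by decide)
  have ac : NotInt (a - c) := hG.2 0 2 (by decide)
  have ad : NotInt (a - d) := hG.2 0 3 (by decide)
  have ea : NotInt (e - a) := hG.2 4 0 (by decide)
  have fa : NotInt (f - a) := hG.2 5 0 (by decide)
  have ga : NotInt (g - a) := hG.2 6 0 (by decide)
  have eb : NotInt (e - b) := hG.2 4 1 (by decide)
  have ec : NotInt (e - c) := hG.2 4 2 (by decide)
  have ed : NotInt (e - d) := hG.2 4 3 (by decide)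
  have fb : NotInt (f - b) := hG.2 5 1 (by decide)
  have fc : NotInt (f - c) := hG.2 5 2 (by decide)
  have fd : NotInt (f - d) := hG.2 5 3 (by decide)
  have ef : NotInt (e - f) := hG.2 4 5 (by decide)
  have ge : NotInt (g - e) := hG.2 6 4 (by decide)
  have gf : NotInt (g - f) := hG.2 6 5 (by decide)
  have H := residue_relation (u₁ := 0) (u₂ := 1 - e) (u₃ := 1 - f) (v := a) h₁ h₂ h₃ h₄
    (nb.of_eq_sub 1 (by push_cast; ring)) ec fd ga (na.of_eq_add 0 (by push_cast; ring))
    (ea.of_eq_sub 1 (by push_cast; ring)) (fa.of_eq_sub 1 (by push_cast; ring))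
    (ne.of_eq_sub 1 (by push_cast; ring)) (nf.of_eq_sub 1 (by push_cast; ring))
    (ef.of_eq_add 0 (by push_cast; ring)) (ab.of_eq_add 1 (by push_cast; ring))
    (ac.of_eq_add 1 (by push_cast; ring)) (ad.of_eq_add 1 (by push_cast; ring))
    (ng.of_eq_add 0 (by push_cast; ring)) (ge.of_eq_add 1 (by push_cast; ring))
    (gf.of_eq_add 1 (by push_cast; ring)) (nc.of_eq_sub 1 (by push_cast; ring))
    (nd.of_eq_sub 1 (by push_cast; ring)) (eb.of_eq_add 0 (by push_cast; ring))
    (ed.of_eq_add 0 (by push_cast; ring)) (fb.of_eq_add 0 (by push_cast; ring))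
    (fc.of_eq_add 0 (by push_cast; ring))
  have r₀ : Fstar (1 - (g - a)) (a + 0) (a + (1 - e)) (a + (1 - f)) (a + 0 + (1 - b))
      (a + (1 - e) + (e - c)) (a + (1 - f) + (f - d)) =
      Fstar a (1 + a - e) (1 + a - f) (1 + a - g) (1 + a - b) (1 + a - c) (1 + a - d) := by
    simp only [Fstar]
    refine tsum_congr fun k => ?_
    ring_nf
  have r₁ : Fstar (a + 0) (1 - (1 - b)) (1 - (1 - e - 0) - (e - c)) (1 - (1 - f - 0) - (f - d))
      (a + 0 + (g - a)) (1 - (1 - e - 0)) (1 - (1 - f - 0)) = Fstar a b c d e f g := by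
    simp only [Fstar]
    refine tsum_congr fun k => ?_
    ring_nf
  have r₂ : Fstar (a + (1 - e)) (1 - (e - c)) (1 - (0 - (1 - e)) - (1 - b))
      (1 - (1 - f - (1 - e)) - (f - d)) (a + (1 - e) + (g - a)) (1 - (0 - (1 - e)))
      (1 - (1 - f - (1 - e))) =
      Fstar (1 + a - e) (1 + b - e) (1 + c - e) (1 + d - e) (2 - e) (1 + f - e) (1 + g - e) := by
    simp only [Fstar]
    refine tsum_congr fun k => ?_
    ring_nf
  have r₃ : Fstar (a + (1 - f)) (1 - (f - d)) (1 - (0 - (1 - f)) - (1 - b))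
      (1 - (1 - e - (1 - f)) - (e - c)) (a + (1 - f) + (g - a)) (1 - (0 - (1 - f)))
      (1 - (1 - e - (1 - f))) =
      Fstar (1 + a - f) (1 + b - f) (1 + c - f) (1 + d - f) (2 - f) (1 + e - f) (1 + g - f) := by
    simp only [Fstar]
    refine tsum_congr fun k => ?_
    ring_nf
  rw [r₀, r₁, r₂, r₃, Sn_one_sub, show 1 - e - 0 + (e - c) = 1 - c by ring, Sn_one_sub,
    show 1 - f - 0 + (f - d) = 1 - d by ring, Sn_one_sub, sub_zero, sub_zero, Sn_one_sub,
    Sn_one_sub, show (0 : ℂ) - (1 - e) + (1 - b) = e - b by ring,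
    show 1 - f - (1 - e) + (f - d) = e - d by ring,
    show (0 : ℂ) - (1 - f) + (1 - b) = f - b by ring,
    show 1 - e - (1 - f) + (e - c) = f - c by ring, zero_sub, zero_sub, Sn_neg, Sn_neg, Sn_one_sub,
    Sn_one_sub, show 1 - f - (1 - e) = e - f by ring, show 1 - e - (1 - f) = f - e by ring] at H
  rw [H]
  simp only [div_eq_mul_inv, mul_inv, inv_neg]
  ring

/-- The three-term relation expressing the series attached to `a` through those attached to
`0`, `e` and `f`. -/
theorem three_two_relation {a b c d e f g : ℂ} (h : e + f + g = a + b + c + d + 1)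
    (hG : Generic ![a, b, c, d, e, f, g]) :
    Sn (g - a) * Fstar a (1 + a - e) (1 + a - f) (1 + a - g) (1 + a - b) (1 + a - c) (1 + a - d) =
      Sn b * Sn c * Sn d / (Sn e * Sn f) * Fstar a b c d e f g -
      Sn (e - b) * Sn (e - c) * Sn (e - d) / (Sn e * Sn (e - f)) *
        Fstar (1 + a - e) (1 + b - e) (1 + c - e) (1 + d - e) (2 - e) (1 + f - e) (1 + g - e) -
      Sn (f - b) * Sn (f - c) * Sn (f - d) / (Sn f * Sn (f - e)) *
        Fstar (1 + a - f) (1 + b - f) (1 + c - f) (1 + d - f) (2 - f) (1 + e - f) (1 + g - f) := by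
  obtain ⟨a', ha⟩ : ∃ a', a + a' = 0 := ⟨-a, by ring⟩
  obtain ⟨b', hb⟩ : ∃ b', b + b' = 1 / 2 := ⟨1 / 2 - b, by ring⟩
  obtain ⟨c', hc⟩ : ∃ c', c + c' = 0 := ⟨-c, by ring⟩
  obtain ⟨d', hd⟩ : ∃ d', d + d' = 0 := ⟨-d, by ring⟩
  obtain ⟨e', he⟩ : ∃ e', e + e' = 1 / 2 := ⟨1 / 2 - e, by ring⟩
  obtain ⟨f', hf⟩ : ∃ f', f + f' = 1 / 2 := ⟨1 / 2 - f, by ring⟩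
  obtain ⟨g', hg⟩ : ∃ g', g + g' = 1 / 2 := ⟨1 / 2 - g, by ring⟩
  have h' : e' + f' + g' = a' + b' + c' + d' := by
    linear_combination he + hf + hg - ha - hb - hc - hd - h
  set A : ℂ → ℂ := fun z => a + z * a' with hA
  set B : ℂ → ℂ := fun z => b + z * b' with hB
  set C : ℂ → ℂ := fun z => c + z * c' with hC
  set D : ℂ → ℂ := fun z => d + z * d' with hD
  set P : ℂ → ℂ := fun z => e + z * e' with hP
  set Q : ℂ → ℂ := fun z => f + z * f' with hQ
  set R : ℂ → ℂ := fun z => g + z * g' with hR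
  have hline : ∀ z : ℂ, (fun i => ![a, b, c, d, e, f, g] i + z * ![a', b', c', d', e', f', g'] i) =
      ![A z, B z, C z, D z, P z, Q z, R z] := fun z => by
    funext i
    fin_cases i <;> rfl
  have dA : Differentiable ℂ A := by fun_prop
  have dB : Differentiable ℂ B := by fun_prop
  have dC : Differentiable ℂ C := by fun_prop
  have dD : Differentiable ℂ D := by fun_prop
  have dP : Differentiable ℂ P := by fun_prop
  have dQ : Differentiable ℂ Q := by fun_prop
  have dR : Differentiable ℂ R := by fun_prop
  have hs : ∀ z, P z + Q z + R z = A z + B z + C z + D z + 1 := fun z => by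
    simp only [hA, hB, hC, hD, hP, hQ, hR]
    linear_combination h + z * h'
  have h0 : A 0 = a ∧ B 0 = b ∧ C 0 = c ∧ D 0 = d ∧ P 0 = e ∧ Q 0 = f ∧ R 0 = g := by
    simp [hA, hB, hC, hD, hP, hQ, hR]
  have h1 : (1 - B 1).re = 1 / 2 ∧ (P 1 - C 1).re = 1 / 2 ∧ (Q 1 - D 1).re = 1 / 2 ∧
      (R 1 - A 1).re = 1 / 2 := by
    simp only [hA, hB, hC, hD, hP, hQ, hR, one_mul, ha, hb, hc, hd, he, hf, hg]
    norm_num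
  have cA := dA.continuous
  have cB := dB.continuous
  have cC := dC.continuous
  have cD := dD.continuous
  have cP := dP.continuous
  have cQ := dQ.continuous
  have cR := dR.continuous
  clear_value A B C D P Q R
  clear hA hB hC hD hP hQ hR
  set Φ : ℂ → ℂ := fun z => Sn (R z - A z) * Fstar (A z) (1 + A z - P z) (1 + A z - Q z)
        (1 + A z - R z) (1 + A z - B z) (1 + A z - C z) (1 + A z - D z) -
      (Sn (B z) * Sn (C z) * Sn (D z) / (Sn (P z) * Sn (Q z)) *
          Fstar (A z) (B z) (C z) (D z) (P z) (Q z) (R z) -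
        Sn (P z - B z) * Sn (P z - C z) * Sn (P z - D z) / (Sn (P z) * Sn (P z - Q z)) *
          Fstar (1 + A z - P z) (1 + B z - P z) (1 + C z - P z) (1 + D z - P z) (2 - P z)
            (1 + Q z - P z) (1 + R z - P z) -
        Sn (Q z - B z) * Sn (Q z - C z) * Sn (Q z - D z) / (Sn (Q z) * Sn (Q z - P z)) *
          Fstar (1 + A z - Q z) (1 + B z - Q z) (1 + C z - Q z) (1 + D z - Q z) (2 - Q z)
            (1 + P z - Q z) (1 + R z - Q z)) with hΦ
  have hmain : Φ 0 = 0 := by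
    refine eq_zero_of_generic_line (w := ![a', b', c', d', e', f', g']) hG
      (W := {z | 9 / 20 < (1 - B z).re} ∩ {z | 9 / 20 < (P z - C z).re} ∩
        {z | 9 / 20 < (Q z - D z).re} ∩ {z | 9 / 20 < (R z - A z).re}) (E := ∅)
      (fun z hz => ?_) ?_ ⟨1, ?_⟩ Set.countable_empty fun z hzW _ hz => ?_
    · rw [hline] at hz
      have s₁ : Sn (P z) ≠ 0 := (hz.1 4).Sn_ne_zero
      have s₂ : Sn (Q z) ≠ 0 := (hz.1 5).Sn_ne_zero
      have s₃ : Sn (P z - Q z) ≠ 0 := (hz.2 4 5 (by decide)).Sn_ne_zero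
      have s₄ : Sn (Q z - P z) ≠ 0 := (hz.2 5 4 (by decide)).Sn_ne_zero
      have dS := differentiable_Sn
      have g₀ : ∀ {x y : ℂ}, NotInt (x - y) → Gamma (1 + x - y) ≠ 0 := fun hy =>
        (hy.of_eq_add 1 (by push_cast; ring)).Gamma_ne_zero
      have F₀ := differentiableAt_Fstar dA dB dC dD dP dQ dR (fun z => by linear_combination hs z)
        (hz.1 0).Gamma_ne_zero (hz.1 1).Gamma_ne_zero (hz.1 2).Gamma_ne_zero
        (hz.1 3).Gamma_ne_zero
      have F₁ := differentiableAt_Fstar (z₀ := z) dA ((dA.const_add 1).sub dP)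
        ((dA.const_add 1).sub dQ) ((dA.const_add 1).sub dR) ((dA.const_add 1).sub dB)
        ((dA.const_add 1).sub dC) ((dA.const_add 1).sub dD)
        (fun z => by simp only [Pi.sub_apply]; linear_combination hs z) (hz.1 0).Gamma_ne_zero
        (g₀ (hz.2 0 4 (by decide))) (g₀ (hz.2 0 5 (by decide))) (g₀ (hz.2 0 6 (by decide)))
      have F₂ := differentiableAt_Fstar (z₀ := z) ((dA.const_add 1).sub dP)
        ((dB.const_add 1).sub dP) ((dC.const_add 1).sub dP) ((dD.const_add 1).sub dP)
        (dP.const_sub 2) ((dQ.const_add 1).sub dP) ((dR.const_add 1).sub dP)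
        (fun z => by simp only [Pi.sub_apply]; linear_combination hs z)
        (g₀ (hz.2 0 4 (by decide))) (g₀ (hz.2 1 4 (by decide))) (g₀ (hz.2 2 4 (by decide)))
        (g₀ (hz.2 3 4 (by decide)))
      have F₃ := differentiableAt_Fstar (z₀ := z) ((dA.const_add 1).sub dQ)
        ((dB.const_add 1).sub dQ) ((dC.const_add 1).sub dQ) ((dD.const_add 1).sub dQ)
        (dQ.const_sub 2) ((dP.const_add 1).sub dQ) ((dR.const_add 1).sub dQ)
        (fun z => by simp only [Pi.sub_apply]; linear_combination hs z)
        (g₀ (hz.2 0 5 (by decide))) (g₀ (hz.2 1 5 (by decide))) (g₀ (hz.2 2 5 (by decide)))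
        (g₀ (hz.2 3 5 (by decide)))
      simp only [Pi.sub_apply] at F₁ F₂ F₃
      have hS : ∀ {φ : ℂ → ℂ}, Differentiable ℂ φ → DifferentiableAt ℂ (fun z => Sn (φ z)) z :=
        fun hφ => (dS.comp hφ).differentiableAt
      exact ((hS (dR.sub dA)).mul F₁).sub (((((hS dB).mul (hS dC)).mul (hS dD)).div
        ((hS dP).mul (hS dQ)) (mul_ne_zero s₁ s₂)).mul F₀ |>.sub (((((hS (dP.sub dB)).mul
        (hS (dP.sub dC))).mul (hS (dP.sub dD))).div ((hS dP).mul (hS (dP.sub dQ)))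
        (mul_ne_zero s₁ s₃)).mul F₂) |>.sub (((((hS (dQ.sub dB)).mul
        (hS (dQ.sub dC))).mul (hS (dQ.sub dD))).div ((hS dQ).mul (hS (dQ.sub dP)))
        (mul_ne_zero s₂ s₄)).mul F₃))
    · exact (((isOpen_lt continuous_const (by fun_prop)).inter
        (isOpen_lt continuous_const (by fun_prop))).inter
        (isOpen_lt continuous_const (by fun_prop))).inter
        (isOpen_lt continuous_const (by fun_prop))
    · obtain ⟨h₁, h₂, h₃, h₄⟩ := h1
      refine ⟨⟨⟨?_, ?_⟩, ?_⟩, ?_⟩ <;> simp only [Set.mem_ofPred_eq, *] <;> norm_num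
    · rw [hline] at hz
      obtain ⟨⟨⟨h₁, h₂⟩, h₃⟩, h₄⟩ := hzW
      exact sub_eq_zero.mpr (three_two_relation_of_re hz h₁.le h₂.le h₃.le h₄.le)
  obtain ⟨a0, b0, c0, d0, e0, f0, g0⟩ := h0
  rw [hΦ] at hmain
  simp only [a0, b0, c0, d0, e0, f0, g0] at hmain
  exact sub_eq_zero.mp hmain

lemma Sn_mul_add_mul_eq (x y p q r : ℂ) :
    Sn (x - y) * (Sn p * Sn q * Sn r + Sn x * Sn y * Sn (x + y - p - q - r)) =
      Sn y * (Sn (x - p) * Sn (x - q) * Sn (x - r)) -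
        Sn x * (Sn (y - p) * Sn (y - q) * Sn (y - r)) := by
  have hE : ∀ z, Sn z = ((exp (Real.pi * z * I))⁻¹ - exp (Real.pi * z * I)) * I / 2 := fun z => by
    rw [Sn, Complex.sin, ← Complex.exp_neg, neg_mul]
  simp only [hE, mul_sub, mul_add, sub_mul, add_mul, Complex.exp_sub, Complex.exp_add]
  have hx := Complex.exp_ne_zero (Real.pi * x * I)
  have hy := Complex.exp_ne_zero (Real.pi * y * I)
  have hp := Complex.exp_ne_zero (Real.pi * p * I)
  have hq := Complex.exp_ne_zero (Real.pi * q * I)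
  have hr := Complex.exp_ne_zero (Real.pi * r * I)
  generalize exp (Real.pi * x * I) = X at *
  generalize exp (Real.pi * y * I) = Y at *
  generalize exp (Real.pi * p * I) = P at *
  generalize exp (Real.pi * q * I) = Q at *
  generalize exp (Real.pi * r * I) = R at *
  field_simp
  ring

lemma Sn_mul_add_mul_of_saal {a b c d e f g : ℂ} (h : e + f + g = a + b + c + d + 1) :
    Sn (e - f) * (Sn b * Sn c * Sn d + Sn e * Sn f * Sn (g - a)) =
      Sn f * (Sn (e - b) * Sn (e - c) * Sn (e - d)) -
        Sn e * (Sn (f - b) * Sn (f - c) * Sn (f - d)) := by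
  rw [← Sn_mul_add_mul_eq, ← Sn_one_sub (g - a),
    show 1 - (g - a) = e + f - b - c - d by linear_combination -h]

lemma Fstar_swap_lower_left (a b c d e f g : ℂ) :
    Fstar a b c d e f g = Fstar a b c d f e g := by
  simp only [Fstar]
  exact tsum_congr fun k => by ring

lemma Generic.const_sub {v : Fin 7 → ℂ} (h : Generic v) (m : Fin 7 → ℤ) :
    Generic fun i => m i - v i :=
  ⟨fun i => (h.1 i).of_eq_sub (m i) rfl, fun i j hij => (h.2 i j hij).of_eq_sub (m i - m j)
    (by push_cast; ring)⟩

lemma Generic.comp {v : Fin 7 → ℂ} (h : Generic v) {σ : Fin 7 → Fin 7}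
    (hσ : Function.Injective σ) : Generic (v ∘ σ) :=
  ⟨fun i => h.1 (σ i), fun _ _ hij => h.2 _ _ (hσ.ne hij)⟩

lemma Generic.dual {a b c d e f g : ℂ} (h : Generic ![a, b, c, d, e, f, g]) :
    Generic ![1 - a, 1 - b, 1 - c, 1 - d, 2 - e, 2 - f, 2 - g] := by
  convert h.const_sub ![1, 1, 1, 1, 2, 2, 2] using 1
  funext i
  fin_cases i <;> simp

lemma Generic.swap_lower_left {a b c d e f g : ℂ} (h : Generic ![a, b, c, d, e, f, g]) :
    Generic ![a, b, c, d, f, e, g] := by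
  convert h.comp (σ := ![0, 1, 2, 3, 5, 4, 6]) (by decide) using 1
  funext i
  fin_cases i <;> rfl

lemma Generic.swap_lower {a b c d e f g : ℂ} (h : Generic ![a, b, c, d, e, f, g]) :
    Generic ![a, b, c, d, e, g, f] := by
  convert h.comp (σ := ![0, 1, 2, 3, 4, 6, 5]) (by decide) using 1
  funext i
  fin_cases i <;> rfl

lemma dual_difference_relation {a b c d e f g : ℂ} (h : e + f + g = a + b + c + d + 1)
    (hG : Generic ![a, b, c, d, e, f, g]) :
    Fstar (1 - a) (1 - b) (1 - c) (1 - d) (2 - e) (2 - f) (2 - g) -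
        Fstar (e - a) (e - b) (e - c) (e - d) e (1 + e - f) (1 + e - g) =
      -(Sn e / Sn (f - g)) * (Gamma (1 - a) * Gamma (1 - b) * Gamma (1 - c) * Gamma (1 - d) *
          (Gamma (e - a) * Gamma (e - b) * Gamma (e - c) * Gamma (e - d))) *
        ((Gamma (1 + a - f))⁻¹ * (Gamma (1 + b - f))⁻¹ * (Gamma (1 + c - f))⁻¹ *
          (Gamma (1 + d - f))⁻¹ * ((Gamma (1 + a - g))⁻¹ * (Gamma (1 + b - g))⁻¹ *
          (Gamma (1 + c - g))⁻¹ * (Gamma (1 + d - g))⁻¹)) *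
        (Fstar (1 + a - f) (1 + b - f) (1 + c - f) (1 + d - f) (2 - f) (1 + e - f) (1 + g - f) -
          Fstar (1 + a - g) (1 + b - g) (1 + c - g) (1 + d - g) (2 - g) (1 + e - g)
            (1 + f - g)) := by
  have H := difference_relation (by linear_combination -h) hG.dual
  have r₁ : ∀ x y : ℂ, 1 + (1 - x) - (2 - y) = y - x := fun x y => by ring
  have r₂ : ∀ x y : ℂ, 1 + (2 - x) - (2 - y) = 1 + y - x := fun x y => by ring
  have r₃ : ∀ x y : ℂ, 2 - y - (1 - x) = 1 + x - y := fun x y => by ring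
  have r₄ : ∀ x y : ℂ, 2 - y - (2 - x) = x - y := fun x y => by ring
  have r₅ : ∀ y : ℂ, 2 - (2 - y) = y := fun y => by ring
  have r₆ : Sn (2 - e) = -Sn e := by
    rw [show 2 - e = 1 - (e - 1) by ring, Sn_one_sub, ← neg_sub, Sn_neg, Sn_one_sub]
  simp only [r₁, r₂, r₃, r₄, r₅, r₆, neg_div] at H
  exact H

lemma dual_three_two_relation {a b c d e f g : ℂ} (h : e + f + g = a + b + c + d + 1)
    (hG : Generic ![a, b, c, d, e, f, g]) :
    Sn (g - a) * (Fstar (1 - a) (1 - b) (1 - c) (1 - d) (2 - e) (2 - f) (2 - g) +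
        Fstar (1 - a) (e - a) (f - a) (g - a) (1 + b - a) (1 + c - a) (1 + d - a)) =
      Sn (e - b) * Sn (e - c) * Sn (e - d) / (Sn e * Sn (e - f)) *
        (Fstar (1 - a) (1 - b) (1 - c) (1 - d) (2 - e) (2 - f) (2 - g) -
          Fstar (e - a) (e - b) (e - c) (e - d) e (1 + e - f) (1 + e - g)) +
      Sn (f - b) * Sn (f - c) * Sn (f - d) / (Sn f * Sn (f - e)) *
        (Fstar (1 - a) (1 - b) (1 - c) (1 - d) (2 - e) (2 - f) (2 - g) -
          Fstar (f - a) (f - b) (f - c) (f - d) f (1 + f - e) (1 + f - g)) := by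
  have H := three_two_relation (by linear_combination -h) hG.dual
  have T := Sn_mul_add_mul_of_saal h
  have r₁ : ∀ x y : ℂ, 1 + (1 - x) - (2 - y) = y - x := fun x y => by ring
  have r₂ : ∀ x y : ℂ, 1 + (2 - x) - (2 - y) = 1 + y - x := fun x y => by ring
  have r₃ : ∀ x y : ℂ, Sn (2 - y - (1 - x)) = Sn (y - x) := fun x y => by
    rw [← Sn_one_sub]
    ring_nf
  have r₄ : ∀ x y : ℂ, 2 - y - (2 - x) = x - y := fun x y => by ring
  have r₅ : ∀ y : ℂ, 2 - (2 - y) = y := fun y => by ring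
  have r₆ : ∀ y, Sn (2 - y) = -Sn y := fun y => by
    rw [show 2 - y = 1 - (y - 1) by ring, Sn_one_sub, ← neg_sub, Sn_neg, Sn_one_sub]
  have r₇ : ∀ x y : ℂ, 1 + (1 - x) - (1 - y) = 1 + y - x := fun x y => by ring
  have r₈ : Sn (f - e) = -Sn (e - f) := by rw [← Sn_neg, neg_sub]
  simp only [r₁, r₂, r₃, r₄, r₅, r₆, r₇, Sn_one_sub, r₈] at H ⊢
  have s₁ : Sn e ≠ 0 := (hG.1 4).Sn_ne_zero
  have s₂ : Sn f ≠ 0 := (hG.1 5).Sn_ne_zero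
  have s₃ : Sn (e - f) ≠ 0 := (hG.2 4 5 (by decide)).Sn_ne_zero
  rw [mul_add, H]
  generalize Fstar _ _ _ _ _ _ _ = F₀
  generalize Fstar _ _ _ _ e _ _ = F₁
  generalize Fstar _ _ _ _ f _ _ = F₂
  field_simp
  linear_combination F₀ * T

lemma combined_linear_relation {se sf sg W β₂ β₄ ea fa ga ef eg fg Pe Pf Pg F₀ Fe Ff Fg Fa : ℂ}
    (hse : se ≠ 0) (hsf : sf ≠ 0) (hsg : sg ≠ 0) (hef : ef ≠ 0) (heg : eg ≠ 0) (hfg : fg ≠ 0)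
    (hf : ga * Fa = W / (se * sf) * F₀ - Pe / (se * ef) * Fe - Pf / (sf * -ef) * Ff)
    (hg : fa * Fa = W / (se * sg) * F₀ - Pe / (se * eg) * Fe - Pg / (sg * -eg) * Fg)
    (tf : ef * (W + se * sf * ga) = sf * Pe - se * Pf)
    (tg : eg * (W + se * sg * fa) = sg * Pe - se * Pg)
    (t₂ : fg * β₂ = ga * Pf - fa * Pg) (t₄ : fg * β₄ = sg * Pf - sf * Pg)
    (hp : fa * eg - ga * ef = ea * fg) :
    W * β₂ * (F₀ + Fa) - se * (fa * (Pf * Pg) / (fg * ef) * (Ff - Fg) +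
      ea * (Pf * Pg) / (-ef * eg) * (Fe - Fg)) -
      (W * β₂ + se * (fa * ga) * β₄) * (Fe + Fa) = 0 := by
  have hf' : se * Pf * Ff = -(ef * W * F₀) + sf * Pe * Fe + se * sf * ef * ga * Fa := by
    field_simp at hf
    linear_combination -hf
  have hg' : se * Pg * Fg = -(eg * W * F₀) + sg * Pe * Fe + se * sg * eg * fa * Fa := by
    field_simp at hg
    linear_combination -hg
  field_simp
  linear_combination -fa * eg * Pg * hf' + ga * ef * Pf * hg' + ef * eg * W * (F₀ - Fe) * t₂ -
    ef * eg * se * fa * ga * (Fe + Fa) * t₄ - ef * ga * Pf * Fe * tg + eg * fa * Pg * Fe * tf +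
    se * Pf * Pg * (Fg - Fe) * hp

lemma first_term_normalize {p sa sb sc sd fa ga β Ga Gb Gc Gd Ea Eb Ec Ed Fa Ha X : ℂ} (hp : p ≠ 0)
    (hsa : sa ≠ 0) (hsb : sb ≠ 0) (hsc : sc ≠ 0) (hsd : sd ≠ 0) (hGa : Ga ≠ 0) (hGb : Gb ≠ 0)
    (hGc : Gc ≠ 0) (hGd : Gd ≠ 0) (hEa : Ea ≠ 0) (hEb : Eb ≠ 0) (hEc : Ec ≠ 0) (hEd : Ed ≠ 0)
    (hFa : Fa ≠ 0) (hHa : Ha ≠ 0) :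
    1 / (p / (sa * Ga) * (p / (sb * Gb)) * (p / (sc * Gc)) * (p / (sd * Gd))) *
        (1 / (Ea * Eb * Ec * Ed)) * (fa * ga * β / p ^ 4) *
        (X / (sa * Ga ^ 2 * Gb * Gc * Gd * Ea * Fa * Ha)) =
      fa * ga / (p ^ 8 * (Ga * Ea ^ 2 * Eb * Ec * Ed * Fa * Ha)) * (sb * sc * sd * β * X) := by
  field_simp

lemma third_term_normalize {p se ea fa ga W β β' Ga Ea Eb Ec Ed Fa Ha X : ℂ} (hp : p ≠ 0)
    (hea : ea ≠ 0) :
    ea * (W * (fa * ga * β / p ^ 4) + se * fa * ga * (fa * ga * β' / p ^ 4)) / p ^ 4 *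
        (X / (ea * Ea ^ 2 * Eb * Ec * Ed * Ga * Fa * Ha)) =
      fa * ga / (p ^ 8 * (Ga * Ea ^ 2 * Eb * Ec * Ed * Fa * Ha)) *
        ((W * β + se * (fa * ga) * β') * X) := by
  field_simp

lemma second_term_normalize {p sa sb sc sd se ea eb ec ed fa fb fc fd ga gb gc gd Ga Gb Gc Gd
    Ea Eb Ec Ed Fa Fb Fc Fd Ha Hb Hc Hd ef eg fg sf X Y : ℂ} (hp : p ≠ 0) (hsa : sa ≠ 0)
    (hsb : sb ≠ 0) (hsc : sc ≠ 0) (hsd : sd ≠ 0) (hse : se ≠ 0) (hea : ea ≠ 0) (heb : eb ≠ 0)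
    (hec : ec ≠ 0) (hed : ed ≠ 0) (hfa : fa ≠ 0) (hfb : fb ≠ 0) (hfc : fc ≠ 0) (hfd : fd ≠ 0)
    (hga : ga ≠ 0) (hsf : sf ≠ 0) (hef : ef ≠ 0) (heg : eg ≠ 0) (hfg : fg ≠ 0)
    (hGa : Ga ≠ 0) (hGb : Gb ≠ 0) (hGc : Gc ≠ 0) (hGd : Gd ≠ 0) (hEa : Ea ≠ 0)
    (hEb : Eb ≠ 0) (hEc : Ec ≠ 0) (hEd : Ed ≠ 0) (hFa : Fa ≠ 0) (hFb : Fb ≠ 0) (hFc : Fc ≠ 0)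
    (hFd : Fd ≠ 0) (hHa : Ha ≠ 0) (hHb : Hb ≠ 0) (hHc : Hc ≠ 0) (hHd : Hd ≠ 0) :
    se * (1 / (p / (fa * Fa) * (p / (fb * Fb)) * (p / (fc * Fc)) * (p / (fd * Fd)))) *
        (1 / (p / (ga * Ha) * (p / (gb * Hb)) * (p / (gc * Hc)) * (p / (gd * Hd)))) *
        (1 / (Ga * Ea * Fa * Ha)) ^ 2 *
        ((eb * ec * ed / (se * ef) *
            (-(se / fg) * (p / (sa * Ga) * (p / (sb * Gb)) * (p / (sc * Gc)) * (p / (sd * Gd)) *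
              (p / (ea * Ea) * (p / (eb * Eb)) * (p / (ec * Ec)) * (p / (ed * Ed)))) *
              (Fa⁻¹ * Fb⁻¹ * Fc⁻¹ * Fd⁻¹ * (Ha⁻¹ * Hb⁻¹ * Hc⁻¹ * Hd⁻¹)) * X) +
          fb * fc * fd / (sf * -ef) *
            (-(sf / eg) * (p / (sa * Ga) * (p / (sb * Gb)) * (p / (sc * Gc)) * (p / (sd * Gd)) *
              (p / (fa * Fa) * (p / (fb * Fb)) * (p / (fc * Fc)) * (p / (fd * Fd)))) *
              (Ea⁻¹ * Eb⁻¹ * Ec⁻¹ * Ed⁻¹ * (Ha⁻¹ * Hb⁻¹ * Hc⁻¹ * Hd⁻¹)) * Y)) / ga /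
          (sa * (p / (sa * Ga)) ^ 2 * (p / (sb * Gb)) * (p / (sc * Gc)) * (p / (sd * Gd)) *
            (p / (ea * Ea)) * (p / (fa * Fa)) * (p / (ga * Ha)))) =
      fa * ga / (p ^ 8 * (Ga * Ea ^ 2 * Eb * Ec * Ed * Fa * Ha)) *
        -(se * (fa * (fb * fc * fd * (gb * gc * gd)) / (fg * ef) * X +
          ea * (fb * fc * fd * (gb * gc * gd)) / (-ef * eg) * Y)) := by
  field_simp
  ring

lemma NotInt.Gamma_reflect {x y : ℂ} (h : NotInt x) (e : x + y = 1) :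
    Gamma y = Real.pi / (Sn x * Gamma x) := by
  rw [← inv_inv (Gamma y), h.inv_Gamma e, inv_div]

theorem hamming246_KKK_relation (a b c d e f g : ℂ)
    (hsaal : e + f + g = a + b + c + d + 1)
    (hint : ∀ i : Fin 7, ∀ n : ℤ, ![a, b, c, d, e, f, g] i ≠ (n : ℂ))
    (hdiff : ∀ i j : Fin 7, i ≠ j → ∀ n : ℤ,
      ![a, b, c, d, e, f, g] i - ![a, b, c, d, e, f, g] j ≠ (n : ℂ)) :
    Af (1 - a) (1 - b) (1 - c) (1 - d) * Af (1 + a - e) (1 + b - e) (1 + c - e) (1 + d - e) *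
        B2 a b c d e f g * Kf a b c d e f g +
      Sn e * Af (f - a) (f - b) (f - c) (f - d) * Af (g - a) (g - b) (g - c) (g - d) *
        Af a (1 + a - e) (1 + a - f) (1 + a - g) ^ 2 *
        Kf (1 - a) (1 - b) (1 - c) (1 - d) (2 - e) (2 - f) (2 - g) -
      Cf a b c d e f g *
        Kf (1 + a - e) (1 + b - e) (1 + c - e) (1 + d - e) (2 - e) (1 + f - e) (1 + g - e) = 0 := by
  have hG : Generic ![a, b, c, d, e, f, g] := ⟨hint, hdiff⟩
  have na : NotInt a := hG.1 0
  have nb : NotInt b := hG.1 1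
  have nc : NotInt c := hG.1 2
  have nd : NotInt d := hG.1 3
  have ne : NotInt e := hG.1 4
  have nf : NotInt f := hG.1 5
  have ng : NotInt g := hG.1 6
  have ea : NotInt (e - a) := hG.2 4 0 (by decide)
  have eb : NotInt (e - b) := hG.2 4 1 (by decide)
  have ec : NotInt (e - c) := hG.2 4 2 (by decide)
  have ed : NotInt (e - d) := hG.2 4 3 (by decide)
  have fa : NotInt (f - a) := hG.2 5 0 (by decide)
  have fb : NotInt (f - b) := hG.2 5 1 (by decide)
  have fc : NotInt (f - c) := hG.2 5 2 (by decide)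
  have fd : NotInt (f - d) := hG.2 5 3 (by decide)
  have ga : NotInt (g - a) := hG.2 6 0 (by decide)
  have gb : NotInt (g - b) := hG.2 6 1 (by decide)
  have gc : NotInt (g - c) := hG.2 6 2 (by decide)
  have gd : NotInt (g - d) := hG.2 6 3 (by decide)
  have ef : NotInt (e - f) := hG.2 4 5 (by decide)
  have eg : NotInt (e - g) := hG.2 4 6 (by decide)
  have fg : NotInt (f - g) := hG.2 5 6 (by decide)
  have hπ : (Real.pi : ℂ) ≠ 0 := by exact_mod_cast Real.pi_ne_zero
  have shift : ∀ {x y : ℂ}, NotInt (y - x) → NotInt (1 + x - y) := fun h =>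
    h.of_eq_sub 1 (by push_cast; ring)
  have refl₀ : ∀ {x : ℂ}, NotInt x → Gamma (1 - x) = Real.pi / (Sn x * Gamma x) := fun h =>
    h.Gamma_reflect (by ring)
  have refl₁ : ∀ {x y : ℂ}, NotInt (y - x) →
      Gamma (y - x) = Real.pi / (Sn (y - x) * Gamma (1 + x - y)) := fun {x y} h => by
    rw [(shift h).Gamma_reflect (by ring), Sn_one_add_sub]
  have hS : ∀ x y : ℂ, Sn (y - x) = -Sn (x - y) := fun x y => by rw [← Sn_neg, neg_sub]
  have hsaal' : f + e + g = a + b + c + d + 1 := by linear_combination hsaal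
  have hsaal'' : e + g + f = a + b + c + d + 1 := by linear_combination hsaal
  have starf := three_two_relation hsaal hG
  have starg := three_two_relation hsaal'' hG.swap_lower
  have dual := dual_three_two_relation hsaal hG
  have dife := dual_difference_relation hsaal hG
  have diff := dual_difference_relation hsaal' hG.swap_lower_left
  have tf := Sn_mul_add_mul_of_saal hsaal
  have tg := Sn_mul_add_mul_of_saal hsaal''
  have t₂ : Sn (f - g) * (Sn (b - a) * Sn (c - a) * Sn (d - a) +
      Sn (e - 2 * a) * Sn (f - a) * Sn (g - a)) =
      Sn (g - a) * (Sn (f - b) * Sn (f - c) * Sn (f - d)) -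
        Sn (f - a) * (Sn (g - b) * Sn (g - c) * Sn (g - d)) := by
    have := Sn_mul_add_mul_eq (f - a) (g - a) (b - a) (c - a) (d - a)
    rw [show f - a + (g - a) - (b - a) - (c - a) - (d - a) = 1 - (e - 2 * a) by
      linear_combination hsaal, Sn_one_sub] at this
    simp only [sub_sub_sub_cancel_right] at this
    linear_combination this
  have t₄ : Sn (f - g) * (Sn b * Sn c * Sn d + Sn (e - a) * Sn f * Sn g) =
      Sn g * (Sn (f - b) * Sn (f - c) * Sn (f - d)) -
        Sn f * (Sn (g - b) * Sn (g - c) * Sn (g - d)) := by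
    rw [← Sn_mul_add_mul_of_saal (show f + g + e = a + b + c + d + 1 by linear_combination hsaal)]
    ring
  have hp : Sn (f - a) * Sn (e - g) - Sn (g - a) * Sn (e - f) = Sn (e - a) * Sn (f - g) := by
    have := Sn_mul_sub_mul (e - f) (g - a) (e - a)
    rw [show e - a - (e - f) = f - a by ring, show e - a - (g - a) = e - g by ring,
      show f - a - (g - a) = f - g by ring] at this
    linear_combination this
  rw [Fstar_swap_upper a, Fstar_swap_lower a b, Fstar_swap_lower _ _ _ _ (2 - e)] at starg
  rw [Fstar_swap_lower_left _ _ _ _ (2 - f), Fstar_swap_lower _ _ _ _ (2 - g) (1 + f - g)] at diff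
  rw [dife, diff] at dual
  rw [hS e f] at starf
  rw [hS e g] at starg
  have key := combined_linear_relation ne.Sn_ne_zero nf.Sn_ne_zero ng.Sn_ne_zero ef.Sn_ne_zero
    eg.Sn_ne_zero fg.Sn_ne_zero starf starg tf tg t₂ t₄ hp
  rw [hS e f] at dual
  have hdual := eq_div_of_mul_eq ga.Sn_ne_zero ((mul_comm _ _).trans dual)
  rw [refl₀ na, refl₀ nb, refl₀ nc, refl₀ nd, refl₁ ea, refl₁ eb, refl₁ ec, refl₁ ed, refl₁ fa,
    refl₁ fb, refl₁ fc, refl₁ fd] at hdual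
  have r₁ : ∀ x y : ℂ, 1 + (1 - x) - (2 - y) = y - x := fun x y => by ring
  have r₂ : ∀ x y : ℂ, 1 + (1 - x) - (1 - y) = 1 + y - x := fun x y => by ring
  have r₃ : 1 + (1 + a - e) - (2 - e) = a := by ring
  have r₄ : ∀ x y z : ℂ, 1 + (1 + x - y) - (1 + z - y) = 1 + x - z := fun x y z => by ring
  have r₅ : Fstar (1 + a - e) a (1 + a - f) (1 + a - g) (1 + a - b) (1 + a - c) (1 + a - d) =
      Fstar a (1 + a - e) (1 + a - f) (1 + a - g) (1 + a - b) (1 + a - c) (1 + a - d) := by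
    simp only [Fstar]
    exact tsum_congr fun k => by ring
  simp only [Af, Kf, B2, B4, Cf, r₁, r₂, r₃, r₄, r₅]
  rw [hdual, Sn_one_sub, Sn_one_add_sub, refl₀ na, refl₀ nb, refl₀ nc, refl₀ nd, refl₁ ea, refl₁ fa,
    refl₁ fb, refl₁ fc, refl₁ fd, refl₁ ga, refl₁ gb, refl₁ gc, refl₁ gd]
  rw [first_term_normalize hπ na.Sn_ne_zero nb.Sn_ne_zero nc.Sn_ne_zero nd.Sn_ne_zero
    na.Gamma_ne_zero nb.Gamma_ne_zero nc.Gamma_ne_zero nd.Gamma_ne_zero (shift ea).Gamma_ne_zero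
    (shift eb).Gamma_ne_zero (shift ec).Gamma_ne_zero (shift ed).Gamma_ne_zero
    (shift fa).Gamma_ne_zero (shift ga).Gamma_ne_zero,
    third_term_normalize hπ ea.Sn_ne_zero, second_term_normalize hπ na.Sn_ne_zero
    nb.Sn_ne_zero nc.Sn_ne_zero nd.Sn_ne_zero ne.Sn_ne_zero ea.Sn_ne_zero
    eb.Sn_ne_zero ec.Sn_ne_zero ed.Sn_ne_zero
    fa.Sn_ne_zero fb.Sn_ne_zero fc.Sn_ne_zero fd.Sn_ne_zero ga.Sn_ne_zero nf.Sn_ne_zero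
    ef.Sn_ne_zero eg.Sn_ne_zero fg.Sn_ne_zero na.Gamma_ne_zero
    nb.Gamma_ne_zero nc.Gamma_ne_zero nd.Gamma_ne_zero (shift ea).Gamma_ne_zero
    (shift eb).Gamma_ne_zero (shift ec).Gamma_ne_zero (shift ed).Gamma_ne_zero
    (shift fa).Gamma_ne_zero (shift fb).Gamma_ne_zero (shift fc).Gamma_ne_zero
    (shift fd).Gamma_ne_zero (shift ga).Gamma_ne_zero (shift gb).Gamma_ne_zero
    (shift gc).Gamma_ne_zero (shift gd).Gamma_ne_zero, ← mul_add, ← sub_eq_add_neg, ← mul_sub, key,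
    mul_zero]
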